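/- arXiv:1303.0268 — 5 statements merged into one kernel-verified Lean document; each statement's English description precedes it below -/
import Mathlib

section
/- Let X_1,…,X_n be finite sets with |X_i| = N_i and let N = N_1⋯N_n. The maximal information divergence from the independence model satisfies D_{E^1_n} ≤ log(N / max_{i∈[n]} N_i). -/
open scoped BigOperators

section Prelim

variable {𝒳 : Type*} [Fintype 𝒳]

/-- A probability distribution on the finite set `𝒳`, as a nonnegative function summing to 1. -/
def IsProb (p : 𝒳 → ℝ) : Prop := (∀ x, 0 ≤ p x) ∧ ∑ x, p x = 1

/-- Kullback–Leibler divergence with the conventions `0·log 0 = 0` and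
`D(p‖q) = ∞` if `supp p ⊄ supp q`. -/
noncomputable def KL (p q : 𝒳 → ℝ) : EReal :=
  if ∀ x, p x ≠ 0 → q x ≠ 0 then ((∑ x, p x * Real.log (p x / q x) : ℝ) : EReal)
  else ⊤

/-- Information divergence from a model: `D(p‖ℳ) = inf_{q ∈ ℳ} D(p‖q)`. -/
noncomputable def divFrom (p : 𝒳 → ℝ) (M : Set (𝒳 → ℝ)) : EReal :=
  ⨅ q ∈ M, KL p q

/-- Maximal information divergence from a model: `D_ℳ = max_{p ∈ Δ(𝒳)} D(p‖ℳ)`. -/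
noncomputable def maxDiv (M : Set (𝒳 → ℝ)) : EReal :=
  ⨆ (p : 𝒳 → ℝ) (_ : IsProb p), divFrom p M

end Prelim

/-- The independence model: product distributions $p(x) = ∏_i p_i(x_i)$. -/
def indepModel {n : ℕ} (X : Fin n → Type*) [∀ i, Fintype (X i)] :
    Set ((∀ i, X i) → ℝ) :=
  {p | ∃ f : ∀ i, X i → ℝ, (∀ i, IsProb (f i)) ∧ ∀ x, p x = ∏ i, f i (x i)}

/-- The marginal of a distribution on a product set is a distribution. -/
lemma isProb_marginal {ι : Type*} {X : ι → Type*} [Fintype (∀ i, X i)] [∀ i, Fintype (X i)]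
    [∀ i, DecidableEq (X i)] {p : (∀ i, X i) → ℝ} (hp : IsProb p) (k : ι) :
    IsProb fun a : X k => ∑ x, if x k = a then p x else 0 := by
  refine ⟨fun a => Finset.sum_nonneg fun x _ => ?_, ?_⟩
  · split_ifs
    exacts [hp.1 x, le_rfl]
  · rw [Finset.sum_comm]
    simpa using hp.2

/-- The uniform distribution. -/
lemma isProb_uniform {α : Type*} [Fintype α] [Nonempty α] :
    IsProb fun _ : α => (Fintype.card α : ℝ)⁻¹ :=
  ⟨fun _ => by positivity, by simp⟩

/-- If `p ≤ c • q` pointwise, then `D(p‖q) ≤ log c`. -/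
lemma KL_le_log {α : Type*} [Fintype α] {p q : α → ℝ} (hp : IsProb p) (hq : ∀ x, 0 ≤ q x)
    {c : ℝ} (h : ∀ x, p x ≤ c * q x) : KL p q ≤ (Real.log c : EReal) := by
  have hsupp : ∀ x, p x ≠ 0 → q x ≠ 0 := fun x hpx hqx =>
    hpx (le_antisymm (by simpa [hqx] using h x) (hp.1 x))
  rw [KL, if_pos hsupp, EReal.coe_le_coe_iff]
  calc ∑ x, p x * Real.log (p x / q x) ≤ ∑ x, p x * Real.log c := by
        refine Finset.sum_le_sum fun x _ => ?_
        rcases (hp.1 x).eq_or_lt with h0 | h0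
        · simp [← h0]
        · have hqx : 0 < q x := (hq x).lt_of_ne' (hsupp x h0.ne')
          exact mul_le_mul_of_nonneg_left
            (Real.log_le_log (div_pos h0 hqx) ((div_le_iff₀ hqx).2 (h x))) h0.le
    _ = Real.log c := by rw [← Finset.sum_mul, hp.2, one_mul]

/-- The divergence from the independence model is at most `log (N / N_k)` for every factor `k`. -/
lemma divFrom_indepModel_le {n : ℕ} (X : Fin n → Type*) [∀ i, Fintype (X i)]
    [∀ i, Nonempty (X i)] {p : (∀ i, X i) → ℝ} (hp : IsProb p) (k : Fin n) :
    divFrom p (indepModel X) ≤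
      (Real.log ((Fintype.card (∀ i, X i) : ℝ) / (Fintype.card (X k) : ℝ)) : EReal) := by
  classical
  let u : ∀ i, X i → ℝ := fun i _ => (Fintype.card (X i) : ℝ)⁻¹
  let m : X k → ℝ := fun a => ∑ x, if x k = a then p x else 0
  let f : ∀ i, X i → ℝ := Function.update u k m
  have hf : ∀ i, IsProb (f i) := by
    intro i
    rcases eq_or_ne i k with rfl | hi
    · simpa [f] using isProb_marginal hp i
    · simpa [f, hi] using (isProb_uniform : IsProb (u i))
  refine (iInf₂_le (fun x => ∏ i, f i (x i)) ⟨f, hf, fun _ => rfl⟩).trans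
    (KL_le_log hp (fun x => Finset.prod_nonneg fun i _ => (hf i).1 _) fun x => ?_)
  have hmarg : p x ≤ m (x k) := by
    have := Finset.single_le_sum (f := fun y => if y k = x k then p y else 0)
      (fun y _ => by split_ifs; exacts [hp.1 y, le_rfl]) (Finset.mem_univ x)
    simpa [m] using this
  have hprod : ∏ i, f i (x i) =
      m (x k) * ∏ i ∈ Finset.univ.erase k, (Fintype.card (X i) : ℝ)⁻¹ := by
    rw [← Finset.mul_prod_erase _ _ (Finset.mem_univ k)]
    congr 1
    · simp [f]
    · exact Finset.prod_congr rfl fun i hi => by simp [f, u, Finset.ne_of_mem_erase hi]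
  have hcard : (Fintype.card (∀ i, X i) : ℝ) =
      Fintype.card (X k) * ∏ i ∈ Finset.univ.erase k, (Fintype.card (X i) : ℝ) := by
    rw [Fintype.card_pi, Nat.cast_prod,
      Finset.mul_prod_erase _ (fun i => (Fintype.card (X i) : ℝ)) (Finset.mem_univ k)]
  have hP : ∏ i ∈ Finset.univ.erase k, (Fintype.card (X i) : ℝ) ≠ 0 :=
    Finset.prod_ne_zero_iff.2 fun i _ => Nat.cast_ne_zero.2 Fintype.card_ne_zero
  have hk : (Fintype.card (X k) : ℝ) ≠ 0 := Nat.cast_ne_zero.2 Fintype.card_ne_zero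
  rw [hprod, hcard, Finset.prod_inv_distrib, mul_div_cancel_left₀ _ hk, mul_left_comm,
    mul_inv_cancel₀ hP, mul_one]
  exact hmarg

/-- $D_{E^1_n} ≤ \log(N / \max_i N_i)$. -/
theorem maxDiv_indepModel_le {n : ℕ} (hn : 0 < n) (X : Fin n → Type)
    [∀ i, Fintype (X i)] [∀ i, Nonempty (X i)] :
    maxDiv (indepModel X) ≤
      ((Real.log ((Fintype.card (∀ i, X i) : ℝ) /
        (((Finset.univ.sup fun i : Fin n => Fintype.card (X i)) : ℕ) : ℝ))) : EReal) := by
  obtain ⟨k, -, hk⟩ := Finset.exists_mem_eq_sup Finset.univ ⟨⟨0, hn⟩, Finset.mem_univ _⟩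
    fun i : Fin n => Fintype.card (X i)
  rw [hk]
  exact iSup₂_le fun p hp => divFrom_indepModel_le X hp k
end

section
/- If all n visible variables are binary (𝒳 = {0,1}^n) and 1 ≤ k ≤ 2^{n−1}, then the maximal information divergence from the mixture of k product distributions satisfies D_{ℳ_{n,k}} ≤ ( n − ⌊log₂ k⌋ − k / 2^{⌊log₂ k⌋} ) · log(2). -/
open scoped BigOperators

/-- The naïve Bayes model (mixture of $k$ product distributions). -/
def mixProd {n : ℕ} (X : Fin n → Type*) [∀ i, Fintype (X i)] (k : ℕ) :
    Set ((∀ i, X i) → ℝ) :=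
  {p | ∃ (l : Fin k → ℝ) (f : Fin k → ∀ i, X i → ℝ),
    (∀ j, 0 ≤ l j) ∧ ∑ j, l j = 1 ∧ (∀ j i, IsProb (f j i)) ∧
    ∀ x, p x = ∑ j, l j * ∏ i, f j i (x i)}

/-- Among the `r`-element subsets of a finite set, some subset has at least average weight. -/
theorem exists_subset_card_eq_average_le {α : Type*} [DecidableEq α] (w : α → ℝ) (r : ℕ)
    (s : Finset α) (hr : r ≤ s.card) :
    ∃ t ⊆ s, t.card = r ∧ (r : ℝ) * ∑ y ∈ s, w y ≤ s.card * ∑ y ∈ t, w y := by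
  induction s using Finset.strongInduction with
  | H s ih =>
    rcases hr.eq_or_lt with h | h
    · exact ⟨s, subset_rfl, h.symm, by rw [h]⟩
    rcases Nat.eq_zero_or_pos r with rfl | hr0
    · exact ⟨∅, by simp, by simp, by simp⟩
    obtain ⟨y, hy, hmin⟩ := s.exists_min_image w (Finset.card_pos.1 (by omega))
    have hcard := Finset.card_erase_add_one hy
    obtain ⟨t, hts, htc, ht⟩ := ih (s.erase y) (Finset.erase_ssubset hy) (by omega)
    refine ⟨t, hts.trans (Finset.erase_subset _ _), htc, ?_⟩
    have hsum := Finset.add_sum_erase s w hy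
    have hle : ((s.erase y).card : ℝ) * w y ≤ ∑ z ∈ s.erase y, w z := by
      rw [← nsmul_eq_mul]
      exact Finset.card_nsmul_le_sum _ _ _ fun z hz => hmin z (Finset.mem_of_mem_erase hz)
    have hc : (s.card : ℝ) = (s.erase y).card + 1 := by exact_mod_cast hcard.symm
    have hpos : (0 : ℝ) < (s.erase y).card := by
      have : 0 < (s.erase y).card := by omega
      exact_mod_cast this
    rw [hc, ← hsum]
    have hr' : (0 : ℝ) ≤ r := by positivity
    refine le_of_mul_le_mul_left ?_ hpos
    nlinarith [mul_le_mul_of_nonneg_left hle hr']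

/-- If all points of `C` share their first `t` coordinates, then `p` is dominated on `C`, up to the
factor `2 ^ e` with `e = n - t - 1`, by its mass on `C` times the product distribution with point
masses on the first `t` coordinates, the conditional marginal of `p` given `C` at coordinate `t`,
and uniform factors afterwards. -/
theorem exists_prod_dominating {n : ℕ} {p : (Fin n → Fin 2) → ℝ} (hp : ∀ x, 0 ≤ p x)
    (C : Finset (Fin n → Fin 2)) (t e : ℕ) (hte : t + 1 + e = n)
    (hC : ∀ x ∈ C, ∀ y ∈ C, ∀ i : Fin n, i.val < t → x i = y i) :
    ∃ f : Fin n → Fin 2 → ℝ, (∀ i, IsProb (f i)) ∧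
      ∀ x ∈ C, p x ≤ 2 ^ e * ((∑ z ∈ C, p z) * ∏ i, f i (x i)) := by
  have hunif : IsProb (fun _ : Fin 2 => (1 / 2 : ℝ)) := ⟨fun _ => by norm_num, by norm_num⟩
  rcases (Finset.sum_nonneg fun z (_ : z ∈ C) => hp z).eq_or_lt with h0 | hpos
  · refine ⟨fun _ _ => 1 / 2, fun _ => hunif, fun x hx => ?_⟩
    rw [← h0, (Finset.sum_eq_zero_iff_of_nonneg fun z _ => hp z).1 h0.symm x hx]
    simp
  obtain ⟨a, ha⟩ : C.Nonempty := by
    by_contra h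
    simp [Finset.not_nonempty_iff_eq_empty.1 h] at hpos
  set c := ∑ z ∈ C, p z with hc
  let i₀ : Fin n := ⟨t, by omega⟩
  let f : Fin n → Fin 2 → ℝ := fun i b =>
    if i.val < t then (if b = a i then 1 else 0)
    else if i.val = t then (∑ z ∈ C with z i₀ = b, p z) / c else 1 / 2
  refine ⟨f, fun i => ?_, fun x hx => ?_⟩
  · rcases lt_trichotomy i.val t with h | h | h
    · refine ⟨fun b => ?_, ?_⟩
      · simp only [f, h, if_true]; split_ifs <;> norm_num
      · simp [f, h]
    · refine ⟨fun b => ?_, ?_⟩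
      · simp only [f, h, lt_irrefl, if_false, if_true]
        exact div_nonneg (Finset.sum_nonneg fun z _ => hp z) hpos.le
      · simp only [f, h, lt_irrefl, if_false, if_true]
        rw [← Finset.sum_div, Finset.sum_fiberwise, ← hc, div_self hpos.ne']
    · have : f i = fun _ => 1 / 2 := by
        funext b; simp [f, h.not_gt, h.ne']
      rw [this]; exact hunif
  · have hprod : ∏ i, f i (x i) = (∑ z ∈ C with z i₀ = x i₀, p z) / c * (1 / 2) ^ e := by
      have h1 : ∀ i, f i (x i) = if i.val < t then 1 else if i = i₀ then
          (∑ z ∈ C with z i₀ = x i₀, p z) / c else 1 / 2 := by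
        intro i
        by_cases h : i.val < t
        · simp [f, h, hC x hx a ha i h]
        · by_cases h' : i = i₀
          · subst h'; simp [f, i₀]
          · have : i.val ≠ t := fun h'' => h' (Fin.ext h'')
            simp [f, h, h', this]
      have hcard : (Finset.univ.filter fun i : Fin n => t < i.val).card = e := by
        have := Fin.card_Ioi i₀
        have heq : (Finset.univ.filter fun i : Fin n => t < i.val) = Finset.Ioi i₀ := by
          ext i; simp [i₀, Fin.lt_def]
        rw [heq, this]; simp only [i₀]; omega
      rw [Finset.prod_congr rfl fun i _ => h1 i, ← Finset.mul_prod_erase _ _ (Finset.mem_univ i₀)]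
      congr 1
      · simp [i₀]
      · rw [← hcard, ← Finset.prod_const, Finset.prod_filter, ← Finset.mul_prod_erase
          (Finset.univ : Finset (Fin n)) (fun i => if t < i.val then (1 / 2 : ℝ) else 1)
          (Finset.mem_univ i₀)]
        simp only [i₀, lt_irrefl, if_false, one_mul]
        refine Finset.prod_congr rfl fun i hi => ?_
        have hne : i.val ≠ t := fun h => (Finset.mem_erase.1 hi).1 (Fin.ext h)
        rcases lt_or_gt_of_ne hne with h | h
        · simp [h, h.not_gt]
        · simp [h, h.not_gt, (Finset.mem_erase.1 hi).1]
    have hle : p x ≤ ∑ z ∈ C with z i₀ = x i₀, p z :=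
      Finset.single_le_sum (fun z _ => hp z) (by simp [hx])
    rw [hprod]
    have h2 : (2 : ℝ) ^ e * (1 / 2) ^ e = 1 := by rw [← mul_pow]; norm_num
    calc p x ≤ ∑ z ∈ C with z i₀ = x i₀, p z := hle
      _ = ((2 : ℝ) ^ e * (1 / 2) ^ e) * (c * ((∑ z ∈ C with z i₀ = x i₀, p z) / c)) := by
        rw [h2, one_mul, mul_div_cancel₀ _ hpos.ne']
      _ = _ := by ring

/-- Divergence bound from a partition of the cube into `k` cells, given by the fibres of `φ`, with
a dominating product distribution on each cell. -/
theorem divFrom_mixProd_le_of_partition {n k : ℕ} {p : (Fin n → Fin 2) → ℝ} (hp : IsProb p)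
    {ι : Type*} [Fintype ι] [DecidableEq ι] (hι : Fintype.card ι = k)
    (φ : (Fin n → Fin 2) → ι) (e : ι → ℕ) (f : ι → Fin n → Fin 2 → ℝ)
    (hf : ∀ j i, IsProb (f j i))
    (hdom : ∀ x, p x ≤ 2 ^ e (φ x) * ((∑ z with φ z = φ x, p z) * ∏ i, f (φ x) i (x i))) :
    divFrom p (mixProd (fun _ : Fin n => Fin 2) k) ≤
      ((∑ x, p x * (e (φ x) * Real.log 2) : ℝ) : EReal) := by
  let c : ι → ℝ := fun j => ∑ z with φ z = j, p z
  have hc : ∀ j, 0 ≤ c j := fun j => Finset.sum_nonneg fun z _ => hp.1 z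
  let q : (Fin n → Fin 2) → ℝ := fun x => ∑ j, c j * ∏ i, f j i (x i)
  let σ : Fin k ≃ ι := (Fintype.equivFinOfCardEq hι).symm
  have hq : q ∈ mixProd (fun _ : Fin n => Fin 2) k := by
    refine ⟨fun j => c (σ j), fun j => f (σ j), fun j => hc _, ?_, fun j i => hf _ _, fun x => ?_⟩
    · rw [Equiv.sum_comp σ c, ← hp.2]
      exact Finset.sum_fiberwise _ _ _
    · exact (Equiv.sum_comp σ fun j => c j * ∏ i, f j i (x i)).symm
  have hpq : ∀ x, p x ≤ 2 ^ e (φ x) * q x := by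
    refine fun x => (hdom x).trans ?_
    gcongr
    exact Finset.single_le_sum (f := fun j => c j * ∏ i, f j i (x i))
      (fun j _ => mul_nonneg (hc j) (Finset.prod_nonneg fun i _ => (hf j i).1 _))
      (Finset.mem_univ (φ x))
  have hqpos : ∀ x, p x ≠ 0 → 0 < q x := by
    intro x hx
    have h1 : 0 < 2 ^ e (φ x) * q x := (lt_of_le_of_ne (hp.1 x) hx.symm).trans_le (hpq x)
    exact pos_of_mul_pos_right h1 (by positivity)
  refine (iInf₂_le q hq).trans ?_
  rw [KL, if_pos fun x hx => (hqpos x hx).ne']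
  refine EReal.coe_le_coe_iff.2 (Finset.sum_le_sum fun x _ => ?_)
  by_cases hx : p x = 0
  · simp [hx]
  refine mul_le_mul_of_nonneg_left ?_ (hp.1 x)
  rw [← Real.log_pow]
  have hp0 : 0 < p x := lt_of_le_of_ne (hp.1 x) (Ne.symm hx)
  exact Real.log_le_log (div_pos hp0 (hqpos x hx)) ((div_le_iff₀ (hqpos x hx)).2 (hpq x))

/-- for binary variables and $1 ≤ k ≤ 2^{n-1}$,
$D_{ℳ_{n,k}} ≤ (n - ⌊\log_2 k⌋ - k/2^{⌊\log_2 k⌋})\log 2$. -/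
theorem maxDiv_mixProd_binary_le (n k : ℕ) (hn : 0 < n) (hk1 : 1 ≤ k)
    (hk2 : k ≤ 2 ^ (n - 1)) :
    maxDiv (mixProd (fun _ : Fin n => Fin 2) k) ≤
      ((((n : ℝ) - (Nat.log 2 k : ℝ) - (k : ℝ) / (2 : ℝ) ^ (Nat.log 2 k)) *
        Real.log 2 : ℝ) : EReal) := by
  refine iSup₂_le fun p hp => ?_
  set m := Nat.log 2 k with hm
  have hmk : 2 ^ m ≤ k := Nat.pow_log_le_self 2 (by omega)
  have hkm : k < 2 ^ (m + 1) := Nat.lt_pow_succ_log_self (by norm_num) k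
  obtain ⟨r, hr⟩ := Nat.exists_eq_add_of_le hmk
  have hmn : m < n := by
    have := (Nat.pow_le_pow_iff_right (a := 2) (by norm_num)).1 (hmk.trans hk2)
    omega
  have hmn' : 0 < r → m + 1 < n := by
    intro h0
    have := (Nat.pow_lt_pow_iff_right (a := 2) (n := m) (m := n - 1) (by norm_num)).1 (by omega)
    omega
  let pre : (Fin n → Fin 2) → (Fin m → Fin 2) := fun x i => x (Fin.castLE hmn.le i)
  obtain ⟨S, -, hS, hSw⟩ := exists_subset_card_eq_average_le
    (fun y => ∑ z with pre z = y, p z) r (Finset.univ : Finset (Fin m → Fin 2))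
    (by simp; omega)
  rw [Finset.sum_fiberwise, hp.2] at hSw
  have hSsum : (r : ℝ) ≤ 2 ^ m * ∑ x, p x * (if pre x ∈ S then 1 else 0) := by
    have h1 : ∑ y ∈ S, ∑ z with pre z = y, p z = ∑ x, p x * (if pre x ∈ S then 1 else 0) := by
      simp only [Finset.sum_filter]
      rw [Finset.sum_comm]
      simp
    rw [h1] at hSw
    simpa using hSw
  let φ : (Fin n → Fin 2) → (Fin m → Fin 2) ⊕ S := fun x =>
    if h : pre x ∈ S ∧ x ⟨m, hmn⟩ = 1 then Sum.inr ⟨pre x, h.1⟩ else Sum.inl (pre x)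
  let ψ : (Fin m → Fin 2) ⊕ S → (Fin m → Fin 2) := Sum.elim id Subtype.val
  have hψ : ∀ x, ψ (φ x) = pre x := by
    intro x; simp only [φ, ψ]; split_ifs <;> simp
  let b : (Fin m → Fin 2) ⊕ S → ℕ := fun j => if ψ j ∈ S then 1 else 0
  have hb : ∀ j, m + b j < n := by
    intro j
    by_cases h : ψ j ∈ S
    · have := hmn' (hS ▸ Finset.card_pos.2 ⟨_, h⟩)
      simpa [b, h] using this
    · simpa [b, h] using hmn
  have hagree : ∀ j, ∀ x ∈ Finset.univ.filter (fun z => φ z = j),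
      ∀ y ∈ Finset.univ.filter (fun z => φ z = j), ∀ i : Fin n, i.val < m + b j → x i = y i := by
    intro j x hx y hy i hi
    simp only [Finset.mem_filter, Finset.mem_univ, true_and] at hx hy
    have hpre : pre x = pre y := by rw [← hψ x, ← hψ y, hx, hy]
    by_cases him : i.val < m
    · exact congrFun hpre ⟨i, him⟩
    have hj : ψ j ∈ S := by
      by_contra h
      simp [b, h] at hi
      omega
    have hi' : i = ⟨m, hmn⟩ := by
      simp [b, hj] at hi
      exact Fin.ext (by simp; omega)
    have hxS : pre x ∈ S := by rwa [← hψ x, hx]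
    have hyS : pre y ∈ S := hpre ▸ hxS
    subst hi'
    have hxy : φ x = φ y := hx.trans hy.symm
    simp only [φ, hxS, hyS, true_and] at hxy
    split_ifs at hxy with h1 h2 h2
    · rw [h1, h2]
    · omega
  choose f hf hdom using fun j => exists_prod_dominating hp.1 (Finset.univ.filter (φ · = j))
    (m + b j) (n - 1 - (m + b j)) (by have := hb j; omega) (hagree j)
  refine (divFrom_mixProd_le_of_partition (k := k) hp
    (by simp [hS, hr]) φ (fun j => n - 1 - (m + b j)) f hf fun x => hdom (φ x) x (by simp)).trans ?_
  refine EReal.coe_le_coe_iff.2 ?_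
  have hterm : ∀ x, p x * (((n - 1 - (m + b (φ x)) : ℕ) : ℝ) * Real.log 2) =
      ((n - 1 - m) * p x - p x * (if pre x ∈ S then 1 else 0)) * Real.log 2 := by
    intro x
    have h1 := hb (φ x)
    rw [Nat.cast_sub (by omega), Nat.cast_sub (by omega)]
    simp only [b, hψ]
    push_cast
    ring
  rw [Finset.sum_congr rfl fun x _ => hterm x, ← Finset.sum_mul, Finset.sum_sub_distrib,
    ← Finset.mul_sum, hp.2]
  refine mul_le_mul_of_nonneg_right ?_ (Real.log_nonneg (by norm_num))
  have hk : (k : ℝ) / 2 ^ m = 1 + r / 2 ^ m := by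
    rw [hr]; push_cast; field_simp
  have hr2 := (div_le_iff₀' (by positivity)).2 hSsum
  rw [hk]
  linarith
end

section
/- Consider a discrete restricted Boltzmann machine with n visible units of cardinalities N_1,…,N_n and m hidden units of cardinalities M_1,…,M_m. Let A ⊆ [n] and N_A = Π_{i∈A} N_i. If 1 + Σ_{j∈[m]}(M_j − 1) ≥ N_{[n]∖A}, then the maximal information divergence from the RBM model satisfies D_{RBM} ≤ log(N_A / max_{j∈A} N_j). -/
open scoped BigOperators

/-- The discrete restricted Boltzmann machine model: visible marginals of the
Gibbs distribution with interactions $W_{ij}(x_i,h_j)$ and biases $b_i(x_i)$, $c_j(h_j)$. -/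
def discreteRBM {n m : ℕ} (X : Fin n → Type*) [∀ i, Fintype (X i)]
    (Y : Fin m → Type*) [∀ j, Fintype (Y j)] : Set ((∀ i, X i) → ℝ) :=
  {p | ∃ (W : ∀ (i : Fin n) (j : Fin m), X i → Y j → ℝ)
        (b : ∀ i : Fin n, X i → ℝ) (c : ∀ j : Fin m, Y j → ℝ),
    ∀ x, p x =
      (∑ h : ∀ j, Y j, Real.exp ((∑ i, ∑ j, W i j (x i) (h j)) +
        (∑ i, b i (x i)) + (∑ j, c j (h j)))) /
      (∑ x' : ∀ i, X i, ∑ h : ∀ j, Y j, Real.exp ((∑ i, ∑ j, W i j (x' i) (h j)) +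
        (∑ i, b i (x' i)) + (∑ j, c j (h j))))}

section RestrictedBoltzmann

open Filter Topology

variable {n m : ℕ} {X : Fin n → Type*} {Y : Fin m → Type*}

/-- Strictly positive functions that factor over the coordinates. -/
def IsPosProduct (f : (∀ i, X i) → ℝ) : Prop :=
  ∃ a : ∀ i, X i → ℝ, ∀ x, f x = Real.exp (∑ i, a i (x i))

namespace IsPosProduct

lemma mul {f g : (∀ i, X i) → ℝ} (hf : IsPosProduct f) (hg : IsPosProduct g) :
    IsPosProduct fun x => f x * g x := by
  obtain ⟨a, ha⟩ := hf
  obtain ⟨b, hb⟩ := hg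
  refine ⟨fun i y => a i y + b i y, fun x => ?_⟩
  simp only [ha, hb, Finset.sum_add_distrib, Real.exp_add]

lemma one : IsPosProduct fun _ : ∀ i, X i => (1 : ℝ) :=
  ⟨fun _ _ => 0, fun x => by simp⟩

lemma of_coord (i : Fin n) {φ : X i → ℝ} (hφ : ∀ y, 0 < φ y) :
    IsPosProduct fun x : ∀ i, X i => φ (x i) := by
  refine ⟨Function.update (fun _ _ => 0) i fun y => Real.log (φ y), fun x => ?_⟩
  rw [Finset.sum_eq_single i]
  · simp [Real.exp_log (hφ _)]
  · intro k _ hk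
    simp [Function.update_of_ne hk]
  · simp

lemma exp_mul_hammingDist [∀ i, DecidableEq (X i)] (B : Finset (Fin n))
    (z : ∀ i : B, X i) (c : ℝ) :
    IsPosProduct fun x : ∀ i, X i => Real.exp (c * hammingDist z (B.restrict x)) := by
  refine ⟨fun i y => if hi : i ∈ B then if z ⟨i, hi⟩ ≠ y then c else 0 else 0, fun x => ?_⟩
  refine congrArg Real.exp ?_
  rw [← Finset.sum_subset (Finset.subset_univ B) (fun i _ hi => dif_neg hi),
    ← Finset.sum_coe_sort B, hammingDist.eq_def, Finset.card_filter, Nat.cast_sum, Finset.mul_sum]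
  refine Finset.sum_congr rfl fun i _ => ?_
  by_cases hi : z i = x i <;> simp [Finset.restrict, hi]

end IsPosProduct

variable [∀ i, Fintype (X i)] [∀ j, Fintype (Y j)]

lemma IsPosProduct.normalize_mem_discreteRBM {f : (∀ i, X i) → ℝ} (hf : IsPosProduct f)
    {g : ∀ j, Y j → (∀ i, X i) → ℝ} (hg : ∀ j h, IsPosProduct (g j h)) :
    (fun x => (f x * ∏ j, ∑ h, g j h x) / ∑ x', f x' * ∏ j, ∑ h, g j h x') ∈
      discreteRBM X Y := by
  classical
  obtain ⟨b, hb⟩ := hf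
  choose a ha using hg
  have key : ∀ x, f x * ∏ j, ∑ h, g j h x = ∑ h : ∀ j, Y j,
      Real.exp ((∑ i, ∑ j, a j (h j) i (x i)) + (∑ i, b i (x i)) + ∑ _j : Fin m, (0 : ℝ)) := by
    intro x
    rw [Finset.prod_univ_sum, Fintype.piFinset_univ, Finset.mul_sum]
    refine Finset.sum_congr rfl fun h _ => ?_
    rw [Finset.sum_const_zero, add_zero, add_comm, Real.exp_add, ← hb, Finset.sum_comm,
      Real.exp_sum]
    exact congrArg _ (Finset.prod_congr rfl fun j _ => ha _ _ _)
  refine ⟨fun i j y h => a j h i y, b, fun _ _ => 0, fun x => ?_⟩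
  simp only [key]

/-- A partition into cylinder sets over the coordinates in `B`, together with one free coordinate
`i₀`, is resolved in the limit by a restricted Boltzmann machine with enough hidden states. -/
lemma exists_mem_discreteRBM_ge [∀ i, Nonempty (X i)] [∀ j, Nonempty (Y j)]
    (B : Finset (Fin n)) (i₀ : Fin n)
    (hcard : ∏ i ∈ B, Fintype.card (X i) ≤ 1 + ∑ j, (Fintype.card (Y j) - 1))
    (v : (∀ i : B, X i) → X i₀ → ℝ) (hv : ∀ z s, 0 < v z s)
    (hsum : ∑ x : ∀ i, X i, v (B.restrict x) (x i₀) = 1) {δ : ℝ} (hδ : δ < 1) :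
    ∃ r ∈ discreteRBM X Y, ∀ x, δ * v (B.restrict x) (x i₀) ≤ r x := by
  classical
  let z₀ : ∀ i : B, X i := fun _ => Classical.arbitrary _
  let h₀ : ∀ j, Y j := fun _ => Classical.arbitrary _
  obtain ⟨e⟩ : Nonempty ({z : ∀ i : B, X i // z ≠ z₀} ↪ Σ j, {h : Y j // h ≠ h₀ j}) := by
    refine Function.Embedding.nonempty_of_card_le ?_
    rw [Fintype.card_sigma]
    simp only [ne_eq, Fintype.card_subtype_compl, Fintype.card_subtype_eq, Fintype.card_pi]
    rw [Finset.prod_coe_sort B fun i => Fintype.card (X i)]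
    omega
  have he := e.injective.isPartialInv
  let f : ℝ → (∀ i, X i) → ℝ := fun t x =>
    v z₀ (x i₀) * Real.exp (-t * hammingDist z₀ (B.restrict x))
  let G : ℝ → Option {z : ∀ i : B, X i // z ≠ z₀} → (∀ i, X i) → ℝ := fun t o x =>
    o.elim (Real.exp (-t)) fun z => v z.1 (x i₀) / v z₀ (x i₀) *
      (Real.exp (t * hammingDist z₀ z.1) *
        Real.exp (-(t * (Fintype.card B + 1)) * hammingDist z.1 (B.restrict x)))
  let g : ℝ → ∀ j, Y j → (∀ i, X i) → ℝ := fun t j h x =>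
    if hh : h = h₀ j then 1 else G t (Function.partialInv e ⟨j, h, hh⟩) x
  have hf : ∀ t, IsPosProduct (f t) := fun t =>
    (IsPosProduct.of_coord i₀ (hv z₀)).mul (.exp_mul_hammingDist B z₀ _)
  have hG : ∀ t o, IsPosProduct (G t o) := by
    rintro t (_ | z)
    · exact .of_coord i₀ (φ := fun _ => Real.exp (-t)) fun _ => Real.exp_pos _
    · exact (IsPosProduct.of_coord i₀ (φ := fun s => v z.1 s / v z₀ s)
        fun s => div_pos (hv _ _) (hv _ _)).mul
        ((IsPosProduct.of_coord i₀ (φ := fun _ => Real.exp (t * hammingDist z₀ z.1))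
          fun _ => Real.exp_pos _).mul (.exp_mul_hammingDist B z.1 _))
  have hg : ∀ t j h, IsPosProduct (g t j h) := by
    intro t j h
    by_cases hh : h = h₀ j
    · simpa only [g, hh, dite_true] using IsPosProduct.one
    · simpa only [g, hh, dite_false] using hG t _
  have hS : ∀ t j x, ∑ h, g t j h x =
      1 + ∑ h : {h : Y j // h ≠ h₀ j}, G t (Function.partialInv e ⟨j, h⟩) x := by
    intro t j x
    rw [Fintype.sum_eq_add_sum_subtype_ne _ (h₀ j)]
    congr 1
    · simp [g]
    · exact Finset.sum_congr rfl fun h _ => by simp only [g, dif_neg h.2]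
  have hexp : ∀ {c : ℝ}, c < 0 → Tendsto (fun t : ℝ => Real.exp (t * c)) atTop (𝓝 0) :=
    fun hc => Real.tendsto_exp_atBot.comp (tendsto_id.atTop_mul_const_of_neg hc)
  have hG0 : ∀ x o, (∀ z ∈ o, z.1 ≠ B.restrict x) →
      Tendsto (fun t => G t o x) atTop (𝓝 0) := by
    rintro x (_ | z) hz
    · simpa [G] using hexp (c := -1) (by norm_num)
    · have hz : z.1 ≠ B.restrict x := hz z rfl
      have h1 : hammingDist z₀ z.1 ≤ Fintype.card B := hammingDist_le_card_fintype
      have h2 : 1 ≤ hammingDist z.1 (B.restrict x) := hammingDist_pos.2 hz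
      have h1' : (hammingDist z₀ z.1 : ℝ) ≤ Fintype.card B := by exact_mod_cast h1
      have h2' : (1 : ℝ) ≤ hammingDist z.1 (B.restrict x) := by exact_mod_cast h2
      have hc : (hammingDist z₀ z.1 : ℝ) -
          (Fintype.card B + 1) * hammingDist z.1 (B.restrict x) < 0 := by
        nlinarith [(Nat.cast_nonneg (Fintype.card B) : (0 : ℝ) ≤ Fintype.card B)]
      have := (hexp hc).const_mul (v z.1 (x i₀) / v z₀ (x i₀))
      rw [mul_zero] at this
      refine this.congr fun t => ?_
      simp only [G, Option.elim_some]
      rw [← Real.exp_add]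
      ring_nf
  have hS1 : ∀ x j, (∀ h z, Function.partialInv e ⟨j, h⟩ = some z → z.1 ≠ B.restrict x) →
      Tendsto (fun t => ∑ h, g t j h x) atTop (𝓝 1) := by
    intro x j hj
    simp only [hS]
    have := (tendsto_finsetSum Finset.univ fun (h : {h : Y j // h ≠ h₀ j}) _ =>
      hG0 x (Function.partialInv e ⟨j, h⟩) (hj h)).const_add 1
    simpa using this
  have hlim : ∀ x, Tendsto (fun t => f t x * ∏ j, ∑ h, g t j h x) atTop
      (𝓝 (v (B.restrict x) (x i₀))) := by
    intro x
    by_cases hx : B.restrict x = z₀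
    · have := tendsto_finsetProd Finset.univ fun j _ =>
        hS1 x j fun h z _ hz => z.2 (hz.trans hx)
      simpa [f, hx] using this.const_mul (v z₀ (x i₀))
    · obtain ⟨j, k, hk⟩ : ∃ j k, e ⟨B.restrict x, hx⟩ = ⟨j, k⟩ := ⟨_, _, rfl⟩
      have huniq : ∀ j' h z, Function.partialInv e ⟨j', h⟩ = some z → z.1 = B.restrict x →
          (⟨j', h⟩ : Σ j, {h : Y j // h ≠ h₀ j}) = ⟨j, k⟩ := by
        intro j' h z hz hzx
        rw [← (he _ _).1 hz, ← hk]
        exact congrArg e (Subtype.ext hzx)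
      have hf0 : Tendsto (fun t => f t x) atTop (𝓝 0) := by
        have hd : 0 < hammingDist z₀ (B.restrict x) := hammingDist_pos.2 (Ne.symm hx)
        have hc : -(hammingDist z₀ (B.restrict x) : ℝ) < 0 := by
          simpa using hd
        have := (hexp hc).const_mul (v z₀ (x i₀))
        rw [mul_zero] at this
        refine this.congr fun t => ?_
        simp only [f]
        ring_nf
      have hmain : ∀ t, f t x * G t (Function.partialInv e ⟨j, k⟩) x =
          v (B.restrict x) (x i₀) := by
        intro t
        rw [(he _ _).2 hk]
        simp only [f, G, Option.elim_some, hammingDist_self, Nat.cast_zero, mul_zero,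
          Real.exp_zero, mul_one]
        rw [mul_mul_mul_comm, mul_div_cancel₀ _ (hv _ _).ne', ← Real.exp_add]
        simp
      have hj : Tendsto (fun t => f t x * ∑ h, g t j h x) atTop
          (𝓝 (v (B.restrict x) (x i₀))) := by
        have hrest := tendsto_finsetSum (Finset.univ.erase k) fun h hh =>
          hG0 x (Function.partialInv e ⟨j, h⟩) fun z hz hzx =>
            (Finset.mem_erase.1 hh).1 (by simpa using huniq j h z hz hzx)
        have := (hf0.add_const (v (B.restrict x) (x i₀))).add (hf0.mul hrest)
        simp only [zero_add, zero_mul, add_zero] at this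
        refine this.congr fun t => ?_
        rw [hS, ← Finset.add_sum_erase _ _ (Finset.mem_univ k), ← hmain t]
        ring
      have hothers := tendsto_finsetProd (Finset.univ.erase j) fun j' hj' =>
        hS1 x j' fun h z hz hzx => (Finset.mem_erase.1 hj').1
          (congrArg Sigma.fst (huniq j' h z hz hzx))
      have := hj.mul hothers
      rw [Finset.prod_const_one, mul_one] at this
      refine this.congr fun t => ?_
      rw [← Finset.mul_prod_erase _ _ (Finset.mem_univ j), mul_assoc]
  have hZ := tendsto_finsetSum Finset.univ fun x (_ : x ∈ Finset.univ) => hlim x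
  rw [hsum] at hZ
  have hev : ∀ᶠ t in atTop, ∀ x, δ * v (B.restrict x) (x i₀) ≤
      (f t x * ∏ j, ∑ h, g t j h x) / ∑ x', f t x' * ∏ j, ∑ h, g t j h x' := by
    refine eventually_all.2 fun x => ?_
    refine ((hlim x).div hZ one_ne_zero).eventually_const_le ?_
    rw [div_one]
    nlinarith [hv (B.restrict x) (x i₀)]
  obtain ⟨t, ht⟩ := hev.exists
  exact ⟨_, (hf t).normalize_mem_discreteRBM (hg t), ht⟩

lemma card_filter_agree_on [∀ i, DecidableEq (X i)] (C : Finset (Fin n)) (y : ∀ i, X i) :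
    (Finset.univ.filter fun x : ∀ i, X i => ∀ i ∈ C, x i = y i).card =
      ∏ i ∈ Cᶜ, Fintype.card (X i) := by
  have : (Finset.univ.filter fun x : ∀ i, X i => ∀ i ∈ C, x i = y i) =
      Fintype.piFinset fun i => if i ∈ C then {y i} else Finset.univ := by
    ext x
    simp only [Finset.mem_filter, Finset.mem_univ, true_and, Fintype.mem_piFinset]
    refine forall_congr' fun i => ?_
    split_ifs with hi <;> simp [hi]
  rw [this, Fintype.card_piFinset, ← Finset.prod_subset (Finset.subset_univ Cᶜ)]
  · refine Finset.prod_congr rfl fun i hi => ?_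
    rw [if_neg (Finset.mem_compl.1 hi), Finset.card_univ]
  · intro i _ hi
    rw [if_pos (by simpa using hi), Finset.card_singleton]

lemma KL_le_of_mul_le {𝒳 : Type*} [Fintype 𝒳] {p r : 𝒳 → ℝ} (hp : IsProb p) {c : ℝ}
    (hc : 0 < c) (hr : ∀ x, c * p x ≤ r x) : KL p r ≤ ((-Real.log c : ℝ) : EReal) := by
  have hpos : ∀ x, p x ≠ 0 → 0 < p x := fun x hx => lt_of_le_of_ne (hp.1 x) hx.symm
  have hrpos : ∀ x, p x ≠ 0 → 0 < r x := fun x hx => (mul_pos hc (hpos x hx)).trans_le (hr x)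
  rw [KL, if_pos fun x hx => (hrpos x hx).ne', EReal.coe_le_coe_iff,
    ← one_mul (-Real.log c), ← hp.2, Finset.sum_mul]
  refine Finset.sum_le_sum fun x _ => ?_
  by_cases hx : p x = 0
  · simp [hx]
  · refine mul_le_mul_of_nonneg_left ?_ (hp.1 x)
    rw [← Real.log_inv]
    refine Real.log_le_log (div_pos (hpos x hx) (hrpos x hx)) ?_
    rw [div_le_iff₀ (hrpos x hx), inv_mul_eq_div, le_div_iff₀ hc, mul_comm]
    exact hr x

lemma exists_mem_discreteRBM_mul_le [∀ i, Nonempty (X i)] [∀ j, Nonempty (Y j)]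
    (A : Finset (Fin n)) (i₀ : Fin n)
    (hcard : ∏ i ∈ Aᶜ, Fintype.card (X i) ≤ 1 + ∑ j, (Fintype.card (Y j) - 1))
    {p : (∀ i, X i) → ℝ} (hp : IsProb p) {δ : ℝ} (hδ₀ : 0 < δ) (hδ : δ < 1) :
    ∃ r ∈ discreteRBM X Y, ∀ x,
      δ ^ 2 / ((∏ i ∈ A.erase i₀, Fintype.card (X i) : ℕ) : ℝ) * p x ≤ r x := by
  classical
  set L : ℝ := ((∏ i ∈ A.erase i₀, Fintype.card (X i) : ℕ) : ℝ) with hL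
  have hLpos : 0 < L := by
    rw [hL, Nat.cast_pos]
    exact Finset.prod_pos fun i _ => Fintype.card_pos
  set K : ℝ := ((Fintype.card (∀ i, X i) : ℕ) : ℝ) with hK
  have hKpos : 0 < K := by
    rw [hK, Nat.cast_pos]
    exact Fintype.card_pos
  let P : (∀ i : (Aᶜ : Finset (Fin n)), X i) → X i₀ → ℝ := fun z s =>
    ∑ x, if Aᶜ.restrict x = z ∧ x i₀ = s then p x else 0
  have hP : ∀ z s, 0 ≤ P z s := fun z s =>
    Finset.sum_nonneg fun x _ => by split_ifs; exacts [hp.1 x, le_rfl]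
  have hpP : ∀ x, p x ≤ P (Aᶜ.restrict x) (x i₀) := by
    intro x
    have := Finset.single_le_sum (f := fun x' =>
      if Aᶜ.restrict x' = Aᶜ.restrict x ∧ x' i₀ = x i₀ then p x' else 0)
      (fun x' _ => by split_ifs; exacts [hp.1 x', le_rfl]) (Finset.mem_univ x)
    simpa using this
  have hfiber : ∀ x' : ∀ i, X i, ((Finset.univ.filter fun x : ∀ i, X i =>
      Aᶜ.restrict x' = Aᶜ.restrict x ∧ x' i₀ = x i₀).card : ℝ) = L := by
    intro x'
    have hC : (insert i₀ Aᶜ)ᶜ = A.erase i₀ := by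
      ext i
      simp
    rw [hL, ← hC, ← card_filter_agree_on _ x']
    congr 2
    ext x
    simp only [Finset.mem_filter, Finset.mem_univ, true_and, Finset.forall_mem_insert,
      funext_iff, Finset.restrict, Subtype.forall]
    rw [and_comm]
    simp only [eq_comm]
  have hPsum : ∑ x : ∀ i, X i, P (Aᶜ.restrict x) (x i₀) = L := by
    rw [Finset.sum_comm]
    simp only [← Finset.sum_filter, Finset.sum_const, nsmul_eq_mul, hfiber]
    rw [← Finset.mul_sum, hp.2, mul_one]
  obtain ⟨r, hr, hvr⟩ := exists_mem_discreteRBM_ge (Y := Y) Aᶜ i₀ hcard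
    (fun z s => δ * (P z s / L) + (1 - δ) / K)
    (fun z s => add_pos_of_nonneg_of_pos (mul_nonneg hδ₀.le (div_nonneg (hP z s) hLpos.le))
      (div_pos (sub_pos.2 hδ) hKpos))
    (by
      rw [Finset.sum_add_distrib, ← Finset.mul_sum, ← Finset.sum_div, hPsum, Finset.sum_const,
        Finset.card_univ, nsmul_eq_mul, ← hK]
      field_simp
      ring) hδ
  refine ⟨r, hr, fun x => le_trans ?_ (hvr x)⟩
  calc δ ^ 2 / L * p x = δ * (δ * (p x / L)) := by ring
    _ ≤ δ * (δ * (P (Aᶜ.restrict x) (x i₀) / L) + (1 - δ) / K) := by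
      have h1 : p x / L ≤ P (Aᶜ.restrict x) (x i₀) / L :=
        div_le_div_of_nonneg_right (hpP x) hLpos.le
      have h2 : 0 ≤ (1 - δ) / K := (div_pos (sub_pos.2 hδ) hKpos).le
      have h3 := mul_le_mul_of_nonneg_left h1 hδ₀.le
      exact mul_le_mul_of_nonneg_left (by linarith) hδ₀.le

end RestrictedBoltzmann

/-- if $1 + ∑_j (M_j - 1) ≥ N_{[n]∖A}$ then
$D_{RBM} ≤ \log(N_A / \max_{j∈A} N_j)$. -/
theorem maxDiv_discreteRBM_le {n m : ℕ} (X : Fin n → Type) (Y : Fin m → Type)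
    [∀ i, Fintype (X i)] [∀ i, Nonempty (X i)]
    [∀ j, Fintype (Y j)] [∀ j, Nonempty (Y j)]
    (A : Finset (Fin n)) (hA : A.Nonempty)
    (h : ∏ i ∈ Aᶜ, Fintype.card (X i) ≤ 1 + ∑ j, (Fintype.card (Y j) - 1)) :
    maxDiv (discreteRBM X Y) ≤
      ((Real.log (((∏ i ∈ A, Fintype.card (X i) : ℕ) : ℝ) /
        (((A.sup fun j : Fin n => Fintype.card (X j)) : ℕ) : ℝ))) : EReal) := by
  classical
  obtain ⟨i₀, hi₀, hsup⟩ := A.exists_mem_eq_sup hA fun j => Fintype.card (X j)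
  have hN : (Fintype.card (X i₀) : ℝ) ≠ 0 := by exact_mod_cast Fintype.card_ne_zero
  have hLpos : (0 : ℝ) < ((∏ i ∈ A.erase i₀, Fintype.card (X i) : ℕ) : ℝ) := by
    rw [Nat.cast_pos]
    exact Finset.prod_pos fun i _ => Fintype.card_pos
  rw [hsup, ← Finset.mul_prod_erase A _ hi₀, Nat.cast_mul, mul_div_cancel_left₀ _ hN]
  refine iSup₂_le fun p hp => EReal.le_of_forall_lt_iff_le.1 fun b hb => ?_
  rw [EReal.coe_lt_coe_iff] at hb
  set L : ℝ := ((∏ i ∈ A.erase i₀, Fintype.card (X i) : ℕ) : ℝ)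
  have hδ : Real.exp ((Real.log L - b) / 2) < 1 := Real.exp_lt_one_iff.2 (by linarith)
  obtain ⟨r, hr, hpr⟩ := exists_mem_discreteRBM_mul_le (Y := Y) A i₀ h hp (Real.exp_pos _) hδ
  refine (iInf₂_le r hr).trans
    ((KL_le_of_mul_le hp (div_pos (pow_pos (Real.exp_pos _) 2) hLpos) hpr).trans ?_)
  rw [EReal.coe_le_coe_iff, Real.log_div (pow_pos (Real.exp_pos _) 2).ne' hLpos.ne',
    Real.log_pow, Real.log_exp]
  push_cast
  linarith
end

section
/- For the binary restricted Boltzmann machine RBM_{n,m} with n visible and m hidden binary units, if m ≤ 2^{n−1} − 1 then the maximal information divergence satisfies D_{RBM_{n,m}} ≤ ( n − ⌊log₂(m+1)⌋ − (m+1) / 2^{⌊log₂(m+1)⌋} ) · log(2). -/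
open scoped BigOperators

/-- The binary restricted Boltzmann machine model $RBM_{n,m}$: visible marginals of
$p(x,h) ∝ \exp(xᵀWh + bᵀx + cᵀh)$ for binary $x ∈ \{0,1\}^n$, $h ∈ \{0,1\}^m$. -/
def binRBM (n m : ℕ) : Set ((Fin n → Fin 2) → ℝ) :=
  {p | ∃ (W : Fin n → Fin m → ℝ) (b : Fin n → ℝ) (c : Fin m → ℝ),
    ∀ x, p x =
      (∑ h : Fin m → Fin 2, Real.exp ((∑ i, ∑ j, W i j * ((x i : ℕ) : ℝ) * ((h j : ℕ) : ℝ)) +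
        (∑ i, b i * ((x i : ℕ) : ℝ)) + (∑ j, c j * ((h j : ℕ) : ℝ)))) /
      (∑ x' : Fin n → Fin 2, ∑ h : Fin m → Fin 2,
        Real.exp ((∑ i, ∑ j, W i j * ((x' i : ℕ) : ℝ) * ((h j : ℕ) : ℝ)) +
        (∑ i, b i * ((x' i : ℕ) : ℝ)) + (∑ j, c j * ((h j : ℕ) : ℝ))))}

/-- Affine functions of the coordinates on the binary cube. -/
def IsAffine {n : ℕ} (g : (Fin n → Fin 2) → ℝ) : Prop :=
  ∃ (w : Fin n → ℝ) (c : ℝ), ∀ x, g x = ∑ i, w i * ((x i : ℕ) : ℝ) + c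

namespace IsAffine

variable {n : ℕ} {f g : (Fin n → Fin 2) → ℝ}

lemma const (c : ℝ) : IsAffine (fun _ : Fin n → Fin 2 => c) := ⟨0, c, by simp⟩

lemma add (hf : IsAffine f) (hg : IsAffine g) : IsAffine (fun x => f x + g x) := by
  obtain ⟨w, c, h⟩ := hf
  obtain ⟨w', c', h'⟩ := hg
  refine ⟨w + w', c + c', fun x => ?_⟩
  simp only [h, h', Pi.add_apply, add_mul, Finset.sum_add_distrib]
  ring

lemma const_mul (a : ℝ) (hf : IsAffine f) : IsAffine (fun x => a * f x) := by
  obtain ⟨w, c, h⟩ := hf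
  refine ⟨fun i => a * w i, a * c, fun x => ?_⟩
  simp only [h, mul_add, Finset.mul_sum, mul_assoc]

lemma sub (hf : IsAffine f) (hg : IsAffine g) : IsAffine (fun x => f x - g x) := by
  simpa [sub_eq_add_neg] using hf.add (hg.const_mul (-1))

lemma apply (φ : Fin 2 → ℝ) (i : Fin n) : IsAffine (fun x => φ (x i)) := by
  refine ⟨Pi.single i (φ 1 - φ 0), φ 0, fun x => ?_⟩
  rw [Finset.sum_eq_single i (by intro b _ hb; simp [hb]) (by simp)]
  rcases Fin.exists_fin_two.mp ⟨x i, rfl⟩ with h | h <;> simp [h]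

lemma sum {ι : Type*} (s : Finset ι) {F : ι → (Fin n → Fin 2) → ℝ}
    (h : ∀ i, IsAffine (F i)) : IsAffine (fun x => ∑ i ∈ s, F i x) := by
  classical
  induction s using Finset.induction_on with
  | empty => simpa using const 0
  | insert a s ha ih => simpa [Finset.sum_insert ha] using (h a).add ih

/-- A function that depends only on one coordinate on a set agrees there with an affine one. -/
lemma exists_eqOn (P : (Fin n → Fin 2) → Prop) (g : (Fin n → Fin 2) → ℝ) (i : Fin n)
    (h : ∀ x y, P x → P y → x i = y i → g x = g y) :
    ∃ A, IsAffine A ∧ ∀ x, P x → A x = g x := by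
  have hφ : ∀ a : Fin 2, ∃ c, ∀ x, P x → x i = a → g x = c := by
    intro a
    by_cases ha : ∃ y, P y ∧ y i = a
    · obtain ⟨y, hy, rfl⟩ := ha
      exact ⟨g y, fun x hx hxy => h x y hx hy hxy⟩
    · exact ⟨0, fun x hx hxa => absurd ⟨x, hx, hxa⟩ ha⟩
  choose φ hφ using hφ
  exact ⟨fun x => φ (x i), apply φ i, fun x hx => (hφ _ x hx rfl).symm⟩

end IsAffine

/-- Summing out the hidden units: a log-affine function times `m` factors of the form
`1 + exp (affine)` is, after normalization, in the RBM model. -/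
lemma mem_binRBM_of_isAffine {n m : ℕ} {a : (Fin n → Fin 2) → ℝ}
    {A : Fin m → (Fin n → Fin 2) → ℝ} (ha : IsAffine a) (hA : ∀ j, IsAffine (A j)) :
    (fun x => (Real.exp (a x) * ∏ j, (1 + Real.exp (A j x))) /
      ∑ y, Real.exp (a y) * ∏ j, (1 + Real.exp (A j y))) ∈ binRBM n m := by
  obtain ⟨b, c₀, hb⟩ := ha
  choose W c hW using hA
  have key : ∀ x : Fin n → Fin 2, Real.exp (a x) * ∏ j, (1 + Real.exp (A j x)) =
      Real.exp c₀ * ∑ h : Fin m → Fin 2,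
        Real.exp ((∑ i, ∑ j, W j i * ((x i : ℕ) : ℝ) * ((h j : ℕ) : ℝ)) +
          (∑ i, b i * ((x i : ℕ) : ℝ)) + (∑ j, c j * ((h j : ℕ) : ℝ))) := by
    intro x
    have h1 : ∏ j, (1 + Real.exp (A j x)) =
        ∑ h : Fin m → Fin 2, ∏ j, Real.exp (A j x * ((h j : ℕ) : ℝ)) := by
      have := Finset.prod_univ_sum (fun _ : Fin m => (Finset.univ : Finset (Fin 2)))
        (fun j v => Real.exp (A j x * ((v : ℕ) : ℝ)))
      simpa [Fin.sum_univ_two, Fintype.piFinset_univ] using this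
    rw [h1, Finset.mul_sum, Finset.mul_sum]
    refine Finset.sum_congr rfl fun h _ => ?_
    rw [← Real.exp_sum, ← Real.exp_add, ← Real.exp_add, hb, Finset.sum_comm]
    congr 1
    simp only [hW, add_mul, Finset.sum_mul, Finset.sum_add_distrib]
    ring
  refine ⟨fun i j => W j i, b, c, fun x => ?_⟩
  simp only [key]
  rw [← Finset.mul_sum, mul_div_mul_left _ _ (Real.exp_pos _).ne']

/-- Approximation by an RBM of a function that is log-affine on each piece of a partition of the
cube into `m + 1` faces; `N b` is an affine function vanishing on the piece `b` and at least `1`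
elsewhere. -/
lemma exists_mem_binRBM_approx {n m : ℕ} {B : Type*} [Fintype B] (hB : Fintype.card B = m + 1)
    (blk : (Fin n → Fin 2) → B) (N : B → (Fin n → Fin 2) → ℝ) (hN : ∀ b, IsAffine (N b))
    (hN0 : ∀ x, N (blk x) x = 0) (hN1 : ∀ b x, blk x ≠ b → 1 ≤ N b x)
    (g : (Fin n → Fin 2) → ℝ) (hg : ∀ b, ∃ A, IsAffine A ∧ ∀ x, blk x = b → A x = g x)
    {δ : ℝ} (hδ : 0 < δ) :
    ∃ F : (Fin n → Fin 2) → ℝ, (fun x => F x / ∑ y, F y) ∈ binRBM n m ∧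
      ∀ x, Real.exp (g x) ≤ F x ∧ F x ≤ Real.exp (g x) + δ := by
  classical
  choose A hA hAg using hg
  have e : B ≃ Option (Fin m) := Fintype.equivOfCardEq (by simp [hB])
  set o := e.symm none with ho
  set s : Fin m → B := fun j => e.symm (some j) with hs
  have hnn : ∀ b x, 0 ≤ N b x := fun b x => by
    by_cases h : blk x = b
    · rw [← h, hN0]
    · linarith [hN1 b x h]
  set C := ∑ x, N o x
  have hNC : ∀ x, N o x ≤ C := fun x =>
    Finset.single_le_sum (f := fun x => N o x) (fun y _ => hnn o y) (Finset.mem_univ x)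
  let E : ℝ → Fin m → (Fin n → Fin 2) → ℝ := fun t j x =>
    A (s j) x - A o x + t * N o x - ((C + 1) * t) * N (s j) x
  let F : ℝ → (Fin n → Fin 2) → ℝ := fun t x =>
    Real.exp (A o x - t * N o x) * ∏ j, (1 + Real.exp (E t j x))
  have hexp : ∀ K r : ℝ, r < 0 →
      Filter.Tendsto (fun t : ℝ => Real.exp (K + t * r)) Filter.atTop (nhds 0) := by
    intro K r hr
    refine Real.tendsto_exp_atBot.comp (Filter.tendsto_atBot_add_const_left _ _ ?_)
    exact Filter.tendsto_id.atTop_mul_const_of_neg hr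
  have hfac : ∀ j x, blk x ≠ s j →
      Filter.Tendsto (fun t => 1 + Real.exp (E t j x)) Filter.atTop (nhds 1) := by
    intro j x hx
    have h1 := hN1 _ x hx
    have h2 := hNC x
    have h3 := hnn o x
    have := (hexp (A (s j) x - A o x) (N o x - (C + 1) * N (s j) x) (by nlinarith)).const_add 1
    rw [add_zero] at this
    refine this.congr fun t => ?_
    simp only [E]
    ring_nf
  have hsplit : ∀ t x j, blk x = s j → F t x =
      (Real.exp (A o x - t * N o x) + Real.exp (g x)) *
        ∏ i ∈ Finset.univ.erase j, (1 + Real.exp (E t i x)) := by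
    intro t x j hx
    simp only [F]
    rw [← Finset.mul_prod_erase _ _ (Finset.mem_univ j), ← mul_assoc, mul_add, mul_one,
      ← Real.exp_add]
    have : A o x - t * N o x + E t j x = g x := by
      simp only [E]
      rw [← hAg _ x hx, ← hx, hN0]
      ring
    rw [this]
  have hbase : ∀ t x, blk x = o → F t x = Real.exp (g x) * ∏ j, (1 + Real.exp (E t j x)) := by
    intro t x hx
    simp only [F]
    rw [← hAg _ x hx, ← hx, hN0]
    simp
  have hcases : ∀ x, blk x = o ∨ ∃ j, blk x = s j := by
    intro x
    rcases h : e (blk x) with _ | j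
    · left; rw [ho, ← h, e.symm_apply_apply]
    · right; exact ⟨j, by simp only [hs]; rw [← h, e.symm_apply_apply]⟩
  have hso : ∀ j, s j ≠ o := fun j h => by simp [hs, ho] at h
  have hss : ∀ i j, s i = s j → i = j := fun i j h => by simpa [hs] using h
  have hone : ∀ t x (u : Finset (Fin m)), 1 ≤ ∏ j ∈ u, (1 + Real.exp (E t j x)) := by
    intro t x u
    exact Finset.one_le_prod fun j _ => by linarith [Real.exp_pos (E t j x)]
  have hlow : ∀ t x, Real.exp (g x) ≤ F t x := by
    intro t x
    rcases hcases x with hx | ⟨j, hx⟩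
    · rw [hbase t x hx]
      exact le_mul_of_one_le_right (Real.exp_pos _).le (hone t x _)
    · rw [hsplit t x j hx]
      have := Real.exp_pos (A o x - t * N o x)
      have := Real.exp_pos (g x)
      nlinarith [hone t x (Finset.univ.erase j)]
  have hlim : ∀ x, Filter.Tendsto (fun t => F t x) Filter.atTop (nhds (Real.exp (g x))) := by
    intro x
    rcases hcases x with hx | ⟨j, hx⟩
    · simp only [hbase _ x hx]
      have := (tendsto_finsetProd Finset.univ fun j (_ : j ∈ Finset.univ) =>
        hfac j x (by rw [hx]; exact (hso j).symm)).const_mul (Real.exp (g x))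
      simpa using this
    · simp only [hsplit _ x j hx]
      have h1 := (hexp (A o x) (-N o x)
        (by linarith [hN1 o x (by rw [hx]; exact hso j)])).add_const (Real.exp (g x))
      have h2 := tendsto_finsetProd (Finset.univ.erase j) fun i (hi : i ∈ Finset.univ.erase j) =>
        hfac i x (by rw [hx]; exact fun h => (Finset.ne_of_mem_erase hi) (hss _ _ h).symm)
      simpa [sub_eq_add_neg] using h1.mul h2
  have hev : ∀ᶠ t in Filter.atTop, ∀ x, F t x < Real.exp (g x) + δ :=
    Filter.eventually_all.mpr fun x => (hlim x).eventually_lt_const (by linarith)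
  obtain ⟨t, ht⟩ := hev.exists
  refine ⟨F t, mem_binRBM_of_isAffine ((hA o).sub ((hN o).const_mul t)) fun j => ?_,
    fun x => ⟨hlow t x, (ht x).le⟩⟩
  exact (((hA (s j)).sub (hA o)).add ((hN o).const_mul t)).sub ((hN (s j)).const_mul _)

/-- Some `r`-element subset carries at least the average weight of `r` elements. -/
lemma exists_subset_card_eq_mul_sum_le {α : Type*} (P : α → ℝ) (T : Finset α) (r : ℕ)
    (hr : r ≤ T.card) :
    ∃ S ⊆ T, S.card = r ∧ r * ∑ a ∈ T, P a ≤ T.card * ∑ a ∈ S, P a := by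
  classical
  obtain ⟨d, hd⟩ := Nat.exists_eq_add_of_le hr
  induction d generalizing T with
  | zero => exact ⟨T, subset_rfl, by simpa using hd, by simp [hd]⟩
  | succ d ih =>
    have hne : T.Nonempty := Finset.card_pos.mp (by omega)
    obtain ⟨a, ha, hmin⟩ := T.exists_min_image P hne
    have hcard : (T.erase a).card = r + d := by rw [Finset.card_erase_of_mem ha]; omega
    obtain ⟨S, hS, hSr, hle⟩ := ih (T.erase a) (by omega) hcard
    refine ⟨S, hS.trans (Finset.erase_subset _ _), hSr, ?_⟩
    have hsum := Finset.sum_erase_add T P ha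
    have havg : (T.card : ℝ) * P a ≤ ∑ b ∈ T, P b := by
      simpa using Finset.card_nsmul_le_sum T P (P a) hmin
    rw [hcard] at hle
    rw [hd] at havg ⊢
    push_cast at hle havg ⊢
    rcases Nat.eq_zero_or_pos (r + d) with h0 | h0
    · obtain ⟨rfl, rfl⟩ : r = 0 ∧ d = 0 := by omega
      simp [Finset.card_eq_zero.mp hSr]
    · have h0' : (0 : ℝ) < r + d := by exact_mod_cast h0
      have hr0 : (0 : ℝ) ≤ r := Nat.cast_nonneg r
      refine le_of_mul_le_mul_left ?_ h0'
      have h1 : ((r : ℝ) + d) * ∑ b ∈ T, P b ≤ (r + d + 1) * ∑ b ∈ T.erase a, P b := by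
        nlinarith
      nlinarith [mul_le_mul_of_nonneg_left h1 hr0,
        mul_le_mul_of_nonneg_left hle (by positivity : (0 : ℝ) ≤ r + d + 1)]

/-- The number of points of the cube with the first `l` coordinates prescribed. -/
lemma card_filter_agree {n l : ℕ} (hl : l ≤ n) (y : Fin n → Fin 2) :
    (Finset.univ.filter fun x : Fin n → Fin 2 => ∀ i : Fin n, (i : ℕ) < l → x i = y i).card =
      2 ^ (n - l) := by
  have h : (Finset.univ.filter fun x : Fin n → Fin 2 => ∀ i : Fin n, (i : ℕ) < l → x i = y i) =
      Fintype.piFinset fun i : Fin n => if (i : ℕ) < l then {y i} else Finset.univ := by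
    ext x
    simp only [Finset.mem_filter, Finset.mem_univ, true_and, Fintype.mem_piFinset]
    refine forall_congr' fun i => ?_
    split_ifs with hi <;> simp [hi]
  rw [h, Fintype.card_piFinset]
  have h2 : ∀ i : Fin n, (if (i : ℕ) < l then {y i} else (Finset.univ : Finset (Fin 2))).card =
      if (i : ℕ) < l then 1 else 2 := fun i => by split_ifs <;> simp
  simp only [h2]
  rw [Fin.prod_univ_eq_prod_range (fun i => if i < l then 1 else 2) n]
  obtain ⟨d, rfl⟩ := Nat.exists_eq_add_of_le hl
  rw [Finset.prod_range_add, Finset.prod_eq_one (by intro i hi; simp [Finset.mem_range.mp hi])]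
  simp

/-- Conditional uniform reallocation: `W` dominates `p` up to the factors `2 ^ (n - l x)`, has total
mass close to `1`, and depends at `x` only on the first `l x` coordinates. -/
lemma exists_locally_uniform {n : ℕ} {p : (Fin n → Fin 2) → ℝ} (hp : IsProb p)
    (l : (Fin n → Fin 2) → ℕ) (hl : ∀ x, l x ≤ n)
    (hconst : ∀ x y : Fin n → Fin 2, (∀ i : Fin n, (i : ℕ) < l x → x i = y i) → l x = l y)
    {η : ℝ} (hη : 0 < η) :
    ∃ W : (Fin n → Fin 2) → ℝ, (∀ x, 0 < W x) ∧ (∀ x, p x ≤ W x * 2 ^ (n - l x)) ∧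
      ∑ x, W x ≤ 1 + η ∧
      ∀ x y : Fin n → Fin 2, (∀ i : Fin n, (i : ℕ) < l x → x i = y i) → W x = W y := by
  classical
  let R : (Fin n → Fin 2) → (Fin n → Fin 2) → Prop :=
    fun x y => ∀ i : Fin n, (i : ℕ) < l x → x i = y i
  have hsymm : ∀ x y, R x y → R y x := fun x y h i hi => (h i (by rwa [hconst x y h])).symm
  have htrans : ∀ x y z, R x y → R y z → R x z := fun x y z h h' i hi =>
    (h i hi).trans (h' i (by rwa [← hconst x y h]))
  let ε := η / 2 ^ n
  have hε : 0 < ε := by positivity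
  let Q : (Fin n → Fin 2) → ℝ := fun x => ∑ y, if R x y then p y else 0
  have hQ0 : ∀ x, 0 ≤ Q x := fun x => Finset.sum_nonneg fun y _ => by
    split_ifs
    exacts [hp.1 y, le_rfl]
  refine ⟨fun x => Q x / 2 ^ (n - l x) + ε, fun x => ?_, fun x => ?_, ?_, fun x y h => ?_⟩
  · have := hQ0 x
    positivity
  · have h1 : p x ≤ Q x := by
      have := Finset.single_le_sum (f := fun y => if R x y then p y else 0)
        (fun y _ => by split_ifs; exacts [hp.1 y, le_rfl]) (Finset.mem_univ x)
      simpa [R] using this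
    have h2 : (0 : ℝ) < 2 ^ (n - l x) := by positivity
    rw [add_mul, div_mul_cancel₀ _ h2.ne']
    linarith [mul_pos hε h2]
  · rw [Finset.sum_add_distrib]
    have h1 : ∑ x : Fin n → Fin 2, ε = η := by
      simp [ε, mul_div_cancel₀]
    have h2 : ∑ x, Q x / 2 ^ (n - l x) = 1 := by
      rw [← hp.2]
      simp only [Q, Finset.sum_div]
      rw [Finset.sum_comm]
      refine Finset.sum_congr rfl fun y _ => ?_
      have h3 : ∀ x, (if R x y then p y else 0) / (2 : ℝ) ^ (n - l x) =
          if (∀ i : Fin n, (i : ℕ) < l y → x i = y i) then p y / 2 ^ (n - l y) else 0 := by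
        intro x
        by_cases h : R x y
        · rw [if_pos h, if_pos fun i hi => (hsymm x y h i hi).symm, hconst x y h]
        · rw [if_neg h, if_neg fun h' => h (hsymm y x fun i hi => (h' i hi).symm), zero_div]
      simp only [h3]
      rw [← Finset.sum_filter, Finset.sum_const, card_filter_agree (hl y), nsmul_eq_mul]
      push_cast
      field_simp
    rw [h1, h2]
  · have : ∀ z, R x z ↔ R y z := fun z => ⟨htrans _ _ _ (hsymm _ _ h), htrans _ _ _ h⟩
    simp only [Q, this, hconst x y h]

/-- A partition of the cube into `m + 1` faces, each fixing a prefix of length `L b < n`, bounds the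
divergence from `RBM_{n,m}`. -/
lemma divFrom_binRBM_le {n m : ℕ} {B : Type*} [Fintype B] (hB : Fintype.card B = m + 1)
    (blk : (Fin n → Fin 2) → B) (L : B → ℕ) (hL : ∀ b, L b < n) (z : B → Fin n → Fin 2)
    (hface : ∀ b x, blk x = b ↔ ∀ i : Fin n, (i : ℕ) < L b → x i = z b i)
    {p : (Fin n → Fin 2) → ℝ} (hp : IsProb p) :
    divFrom p (binRBM n m) ≤
      (((∑ x, p x * ((n : ℝ) - L (blk x) - 1)) * Real.log 2 : ℝ) : EReal) := by
  classical
  have hblk : ∀ x y : Fin n → Fin 2, (∀ i : Fin n, (i : ℕ) < L (blk x) + 1 → x i = y i) →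
      blk y = blk x := fun x y h => (hface _ y).mpr fun i hi => by
    rw [← h i (by omega)]
    exact (hface _ x).mp rfl i hi
  refine EReal.le_of_forall_lt_iff_le.mp fun v hv => ?_
  rw [EReal.coe_lt_coe_iff] at hv
  set D := (∑ x, p x * ((n : ℝ) - L (blk x) - 1)) * Real.log 2
  set η := (v - D) / 2 with hη
  have hη0 : 0 < η := by rw [hη]; linarith
  obtain ⟨W, hW0, hpW, hWsum, hWc⟩ := exists_locally_uniform hp (fun x => L (blk x) + 1)
    (fun x => hL _) (fun x y h => by rw [hblk x y h]) hη0
  let N : B → (Fin n → Fin 2) → ℝ := fun b x =>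
    ∑ i : Fin n, if (i : ℕ) < L b ∧ x i ≠ z b i then 1 else 0
  have hN : ∀ b, IsAffine (N b) := fun b => IsAffine.sum _ fun i =>
    IsAffine.apply (fun a => if (i : ℕ) < L b ∧ a ≠ z b i then 1 else 0) i
  have hN0 : ∀ x, N (blk x) x = 0 := fun x => Finset.sum_eq_zero fun i _ =>
    if_neg fun h => h.2 ((hface _ x).mp rfl i h.1)
  have hN1 : ∀ b x, blk x ≠ b → 1 ≤ N b x := by
    intro b x h
    rw [Ne, hface] at h
    push Not at h
    obtain ⟨i, hi, hne⟩ := h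
    have := Finset.single_le_sum
      (f := fun i : Fin n => if (i : ℕ) < L b ∧ x i ≠ z b i then (1 : ℝ) else 0)
      (fun j _ => by split_ifs <;> norm_num) (Finset.mem_univ i)
    simpa only [if_pos (And.intro hi hne)] using this
  have hg : ∀ b, ∃ A, IsAffine A ∧ ∀ x, blk x = b → A x = Real.log (W x) := by
    intro b
    refine IsAffine.exists_eqOn (fun x => blk x = b) _ ⟨L b, hL b⟩ fun x y hx hy hxy => ?_
    rw [hWc x y fun i hi => ?_]
    rw [hx] at hi
    rcases Nat.lt_succ_iff_lt_or_eq.mp hi with h | h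
    · rw [(hface b x).mp hx i h, (hface b y).mp hy i h]
    · rwa [show i = ⟨L b, hL b⟩ from Fin.ext h]
  obtain ⟨F, hF, hFW⟩ := exists_mem_binRBM_approx hB blk N hN hN0 hN1 _ hg
    (δ := η / 2 ^ n) (by positivity)
  simp only [Real.exp_log (hW0 _)] at hFW
  have hF0 : ∀ x, 0 < F x := fun x => (hW0 x).trans_le (hFW x).1
  set Z := ∑ y, F y
  have hZ0 : 0 < Z := Finset.sum_pos (fun x _ => hF0 x) Finset.univ_nonempty
  have hZle : Z ≤ 1 + η + η := by
    calc Z ≤ ∑ x, (W x + η / 2 ^ n) := Finset.sum_le_sum fun x _ => (hFW x).2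
      _ = ∑ x, W x + η := by
        rw [Finset.sum_add_distrib]
        simp [mul_div_cancel₀]
      _ ≤ _ := by linarith
  refine (iInf₂_le _ hF).trans ?_
  rw [KL, if_pos fun x _ => (div_pos (hF0 x) hZ0).ne', EReal.coe_le_coe_iff]
  have hterm : ∀ x, p x * Real.log (p x / (F x / Z)) ≤
      p x * ((n : ℝ) - L (blk x) - 1) * Real.log 2 + p x * (2 * η) := by
    intro x
    rcases (hp.1 x).eq_or_lt with h0 | h0
    · simp [← h0]
    rw [mul_assoc, ← mul_add]
    refine mul_le_mul_of_nonneg_left ?_ h0.le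
    have h1 : p x / (F x / Z) ≤ 2 ^ (n - (L (blk x) + 1)) * Z := by
      rw [div_le_iff₀ (div_pos (hF0 x) hZ0)]
      have : (2 : ℝ) ^ (n - (L (blk x) + 1)) * Z * (F x / Z) =
          F x * 2 ^ (n - (L (blk x) + 1)) := by field_simp
      rw [this]
      exact (hpW x).trans (mul_le_mul_of_nonneg_right (hFW x).1 (by positivity))
    have h2 := Real.log_le_log (div_pos h0 (div_pos (hF0 x) hZ0)) h1
    rw [Real.log_mul (by positivity) hZ0.ne', Real.log_pow, Nat.cast_sub (hL _)] at h2
    have h3 := Real.log_le_sub_one_of_pos hZ0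
    push_cast at h2
    rw [← sub_sub] at h2
    linarith
  calc _ ≤ ∑ x, (p x * ((n : ℝ) - L (blk x) - 1) * Real.log 2 + p x * (2 * η)) :=
        Finset.sum_le_sum fun x _ => hterm x
    _ = D + 2 * η := by
        rw [Finset.sum_add_distrib, ← Finset.sum_mul, ← Finset.sum_mul, hp.2, one_mul]
    _ = v := by rw [hη]; ring

/-- if $m ≤ 2^{n-1} - 1$ then
$D_{RBM_{n,m}} ≤ (n - ⌊\log_2(m+1)⌋ - (m+1)/2^{⌊\log_2(m+1)⌋})\log 2$. -/
theorem maxDiv_binRBM_le (n m : ℕ) (hn : 0 < n) (hm : m ≤ 2 ^ (n - 1) - 1) :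
    maxDiv (binRBM n m) ≤
      ((((n : ℝ) - (Nat.log 2 (m + 1) : ℝ) -
        ((m + 1 : ℕ) : ℝ) / (2 : ℝ) ^ (Nat.log 2 (m + 1))) * Real.log 2 : ℝ) : EReal) := by
  classical
  set k := Nat.log 2 (m + 1)
  have hk1 : 2 ^ k ≤ m + 1 := Nat.pow_log_le_self 2 (by omega)
  have hk2 : m + 1 < 2 ^ (k + 1) := Nat.lt_pow_succ_log_self (by norm_num) _
  have hm' : m + 1 ≤ 2 ^ (n - 1) := by have := Nat.one_le_two_pow (n := n - 1); omega
  have hkn : k < n := by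
    have := (Nat.pow_le_pow_iff_right (by norm_num : 1 < 2)).mp (hk1.trans hm')
    omega
  obtain ⟨r, hr⟩ := Nat.exists_eq_add_of_le hk1
  have hr2 : r ≤ 2 ^ k := by rw [pow_succ] at hk2; omega
  have hkn' : 0 < r → k + 1 < n := by
    intro h
    have := (Nat.pow_lt_pow_iff_right (by norm_num : 1 < 2)).mp
      (show 2 ^ k < 2 ^ (n - 1) by omega)
    omega
  refine iSup₂_le fun p hp => ?_
  let res : (Fin n → Fin 2) → Fin k → Fin 2 := fun x i => x (Fin.castLE hkn.le i)
  let P : (Fin k → Fin 2) → ℝ := fun a => ∑ x, if res x = a then p x else 0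
  obtain ⟨S, -, hSr, hSle⟩ := exists_subset_card_eq_mul_sum_le P Finset.univ r (by simpa using hr2)
  let κ : Fin n := ⟨k, hkn⟩
  let blk : (Fin n → Fin 2) → (Fin k → Fin 2) ⊕ S := fun x =>
    if h : res x ∈ S ∧ x κ = 1 then Sum.inr ⟨res x, h.1⟩ else Sum.inl (res x)
  let L : (Fin k → Fin 2) ⊕ S → ℕ :=
    Sum.elim (fun a => if a ∈ S then k + 1 else k) (fun _ => k + 1)
  let ext : (Fin k → Fin 2) → Fin 2 → Fin n → Fin 2 :=
    fun a c i => if h : (i : ℕ) < k then a ⟨i, h⟩ else c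
  let z : (Fin k → Fin 2) ⊕ S → Fin n → Fin 2 :=
    Sum.elim (fun a => ext a 0) (fun a => ext a 1)
  have hS : ∀ a ∈ S, k + 1 < n := fun a ha => hkn' (by
    rw [← hSr]; exact Finset.card_pos.mpr ⟨a, ha⟩)
  have hL : ∀ b, L b < n := by
    rintro (a | a)
    · simp only [L, Sum.elim_inl]
      split_ifs with h
      exacts [hS a h, hkn]
    · exact hS a a.2
  have hres : ∀ (x : Fin n → Fin 2) a c,
      (∀ i : Fin n, (i : ℕ) < k → x i = ext a c i) ↔ res x = a := by
    intro x a c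
    refine ⟨fun h => funext fun i => ?_, ?_⟩
    · simpa [ext, res] using h (Fin.castLE hkn.le i) (by simp)
    · rintro rfl i hi
      simp [ext, res, hi]
  have hres' : ∀ (x : Fin n → Fin 2) a c,
      (∀ i : Fin n, (i : ℕ) < k + 1 → x i = ext a c i) ↔ res x = a ∧ x κ = c := by
    intro x a c
    rw [← hres x a c]
    refine ⟨fun h => ⟨fun i hi => h i (by omega), ?_⟩, fun h i hi => ?_⟩
    · simpa [ext, κ] using h κ (by simp [κ])
    · rcases Nat.lt_succ_iff_lt_or_eq.mp hi with h' | h'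
      · exact h.1 i h'
      · rw [show i = κ from Fin.ext h', h.2]
        simp [ext, κ]
  have hface : ∀ b x, blk x = b ↔ ∀ i : Fin n, (i : ℕ) < L b → x i = z b i := by
    rintro (a | a) x
    · by_cases ha : a ∈ S
      · simp only [L, z, Sum.elim_inl, if_pos ha, hres', blk]
        split_ifs with h
        · simp [h.2]
        · simp only [Sum.inl.injEq]
          refine ⟨?_, fun h => h.1⟩
          rintro rfl
          refine ⟨rfl, ?_⟩
          have : x κ ≠ 1 := fun h' => h ⟨ha, h'⟩
          omega
      · simp only [L, z, Sum.elim_inl, if_neg ha, hres, blk]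
        split_ifs with h
        · simp only [false_iff]
          rintro rfl
          exact ha h.1
        · simp
    · obtain ⟨a, ha⟩ := a
      simp only [L, z, Sum.elim_inr, hres', blk]
      split_ifs with h
      · simp [h.2]
      · simp only [false_iff]
        rintro ⟨rfl, h'⟩
        exact h ⟨ha, h'⟩
  have hcard : Fintype.card ((Fin k → Fin 2) ⊕ S) = m + 1 := by
    simp [hSr, hr]
  refine (divFrom_binRBM_le hcard blk L hL z hface hp).trans ?_
  rw [EReal.coe_le_coe_iff]
  refine mul_le_mul_of_nonneg_right ?_ (Real.log_nonneg (by norm_num))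
  have hLblk : ∀ x, (L (blk x) : ℝ) = k + if res x ∈ S then 1 else 0 := by
    intro x
    by_cases h : res x ∈ S ∧ x κ = 1
    · simp only [blk, dif_pos h, L, Sum.elim_inr, if_pos h.1]
      push_cast
      rfl
    · simp only [blk, dif_neg h, L, Sum.elim_inl]
      split_ifs <;> simp
  have hPS : ∀ T : Finset (Fin k → Fin 2), ∑ a ∈ T, P a = ∑ x, if res x ∈ T then p x else 0 := by
    intro T
    simp only [P]
    rw [Finset.sum_comm]
    refine Finset.sum_congr rfl fun x _ => ?_
    rw [Finset.sum_ite_eq]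
  have hsum : ∑ x, p x * ((n : ℝ) - L (blk x) - 1) = n - k - 1 - ∑ a ∈ S, P a := by
    have : ∀ x, p x * ((n : ℝ) - L (blk x) - 1) =
        p x * (n - k - 1) - if res x ∈ S then p x else 0 := by
      intro x
      rw [hLblk]
      split_ifs <;> ring
    simp only [this]
    rw [Finset.sum_sub_distrib, ← Finset.sum_mul, hp.2, hPS, one_mul]
  have hP1 : ∑ a, P a = 1 := by rw [hPS]; simpa using hp.2
  rw [hP1] at hSle
  have hSle' : (r : ℝ) / 2 ^ k ≤ ∑ a ∈ S, P a := by
    rw [div_le_iff₀' (by positivity)]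
    simpa using hSle
  have h2k : ((m + 1 : ℕ) : ℝ) / 2 ^ k = 1 + r / 2 ^ k := by
    rw [hr]
    push_cast
    field_simp
  rw [hsum, h2k]
  linarith
end

section
/- Consider a discrete deep belief network with L layers, each layer containing n units with state spaces of cardinalities q_1,…,q_n (each q_i ≥ 2). Let m be an integer with Π_{j=m+2}^{n} q_j ≤ m ≤ n, and suppose q_1 ≥ q_2 ≥ ⋯ ≥ q_m. If L ≥ 2 + (q_1^S − 1)/(q_1 − 1) for some S ∈ {0,1,…,m}, then the maximal information divergence from the DBN model satisfies D_{DBN} ≤ log( Π_{j=1}^{m−S} q_j ). -/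
open scoped BigOperators

/-- Conditional distribution of unit $i$ given the state $z$ of the next layer:
$p_i(y|z) ∝ \exp(∑_j W_j(y, z_j) + b(y))$. -/
noncomputable def dbnCond {n : ℕ} (X : Fin n → Type*) [∀ i, Fintype (X i)] (i : Fin n)
    (W : ∀ j : Fin n, X i → X j → ℝ) (b : X i → ℝ) (y : X i) (z : ∀ j, X j) : ℝ :=
  Real.exp ((∑ j, W j y (z j)) + b y) /
    ∑ y' : X i, Real.exp ((∑ j, W j y' (z j)) + b y')

/-- Joint distribution of a discrete RBM on the deepest two layers:
$r(v,h) = \exp(∑_{ij} W_{ij}(v_i,h_j) + ∑_i b_i(v_i) + ∑_j c_j(h_j))/Z$. -/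
noncomputable def dbnRBMJoint {n : ℕ} (X : Fin n → Type*) [∀ i, Fintype (X i)]
    (W : ∀ i j : Fin n, X i → X j → ℝ) (b c : ∀ i : Fin n, X i → ℝ)
    (v h : ∀ i, X i) : ℝ :=
  Real.exp ((∑ i, ∑ j, W i j (v i) (h j)) + (∑ i, b i (v i)) + (∑ j, c j (h j))) /
    ∑ v' : ∀ i, X i, ∑ h' : ∀ i, X i,
      Real.exp ((∑ i, ∑ j, W i j (v' i) (h' j)) + (∑ i, b i (v' i)) + (∑ j, c j (h' j)))

/-- The discrete deep belief network model with $L' + 2$ layers, each of width $n$ with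
state spaces $X_1,…,X_n$: marginals on the first layer of
$p(x^{(1)},…,x^{(L)}) = r(x^{(L-1)}, x^{(L)}) ∏_{l=1}^{L-2} ∏_i p_i^{(l)}(x_i^{(l)}|x^{(l+1)})$. -/
def discreteDBN {n : ℕ} (X : Fin n → Type) [∀ i, Fintype (X i)] [∀ i, DecidableEq (X i)]
    (L' : ℕ) : Set ((∀ i, X i) → ℝ) :=
  {p | ∃ (W : Fin L' → ∀ i j : Fin n, X i → X j → ℝ)
        (b : Fin L' → ∀ i : Fin n, X i → ℝ)
        (Wr : ∀ i j : Fin n, X i → X j → ℝ) (br cr : ∀ i : Fin n, X i → ℝ),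
    ∀ v, p v = ∑ xs : Fin (L' + 2) → (∀ i, X i),
      if xs 0 = v then
        dbnRBMJoint X Wr br cr (xs ⟨L', by omega⟩) (xs ⟨L' + 1, by omega⟩) *
          ∏ l : Fin L', ∏ i : Fin n,
            dbnCond X i (W l i) (b l i) (xs l.castSucc.castSucc i) (xs l.succ.castSucc)
      else 0}

/-- A value at `0` of a function continuous there lies in the closure of any set containing the
values at positive arguments. -/
lemma apply_zero_mem_closure {α : Type*} [TopologicalSpace α] {f : ℝ → α} {s : Set α}
    (hf : ContinuousAt f 0) (h : ∀ ε, 0 < ε → f ε ∈ s) : f 0 ∈ closure s :=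
  hf.continuousWithinAt.mem_closure (s := Set.Ioi 0) (by simp) fun ε hε => h ε hε

lemma prod_update_one {n : ℕ} {X : Fin n → Type} (i : Fin n) (f : X i → ℝ) (z : ∀ j, X j) :
    ∏ j, Function.update (fun j (_ : X j) => (1 : ℝ)) i f j (z j) = f (z i) := by
  rw [Fintype.prod_eq_single i fun j hj => by rw [Function.update_of_ne hj],
    Function.update_self]

section Kernels

variable {n : ℕ} (X : Fin n → Type) [∀ i, Fintype (X i)]

/-- The conditional distributions of unit `i` given the next layer. -/
def unitKernels (i : Fin n) : Set (X i → (∀ j, X j) → ℝ) :=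
  {κ | ∃ (W : ∀ j, X i → X j → ℝ) (b : X i → ℝ), κ = fun y z => dbnCond X i W b y z}

/-- The visible marginals of the discrete RBM. -/
def rbmMarginals : Set ((∀ i, X i) → ℝ) :=
  {P | ∃ (W : ∀ i j : Fin n, X i → X j → ℝ) (b c : ∀ i, X i → ℝ),
    P = fun v => ∑ h, dbnRBMJoint X W b c v h}

/-- The distribution on a layer generated from the distribution `Q` on the next layer by the
unit-wise kernels `κ`. -/
def propagate (Q : (∀ i, X i) → ℝ) (κ : ∀ i, X i → (∀ j, X j) → ℝ) (x : ∀ i, X i) : ℝ :=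
  ∑ z, Q z * ∏ i, κ i (x i) z

/-- The distributions generated by `l` directed layers on top of which sits an RBM. -/
def layerStack : ℕ → Set ((∀ i, X i) → ℝ)
  | 0 => rbmMarginals X
  | l + 1 => {P | ∃ Q ∈ layerStack l, ∃ κ : ∀ i, X i → (∀ j, X j) → ℝ,
      (∀ i, κ i ∈ unitKernels X i) ∧ P = propagate X Q κ}

variable {X}

lemma unitKernels_closure_of_nonneg (i : Fin n) (U : ∀ j, X i → X j → ℝ)
    (hU : ∀ j y w, 0 ≤ U j y w) (hpos : ∀ z : ∀ j, X j, 0 < ∑ y, ∏ j, U j y (z j)) :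
    (fun y z => (∏ j, U j y (z j)) / ∑ y', ∏ j, U j y' (z j)) ∈ closure (unitKernels X i) := by
  have key := apply_zero_mem_closure (s := unitKernels X i)
    (f := fun ε y z => (∏ j, (U j y (z j) + ε)) / ∑ y', ∏ j, (U j y' (z j) + ε)) ?_ ?_
  · simpa only [add_zero] using key
  · refine continuousAt_pi.2 fun y => continuousAt_pi.2 fun z => ContinuousAt.div ?_ ?_ ?_
    · fun_prop
    · fun_prop
    · simpa only [add_zero] using (hpos z).ne'
  · intro ε hε
    refine ⟨fun j y w => Real.log (U j y w + ε), fun _ => 0, ?_⟩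
    have h : ∀ y (z : ∀ j, X j), Real.exp ((∑ j, Real.log (U j y (z j) + ε)) + 0) =
        ∏ j, (U j y (z j) + ε) := fun y z => by
      rw [add_zero, Real.exp_sum]
      exact Finset.prod_congr rfl fun j _ => Real.exp_log (by linarith [hU j y (z j)])
    simp only [dbnCond, h]

lemma rbmMarginals_closure_of_nonneg (U : ∀ i j : Fin n, X i → X j → ℝ) (γ : ∀ j, X j → ℝ)
    (hU : ∀ i j v h, 0 ≤ U i j v h) (hγ : ∀ j h, 0 ≤ γ j h)
    (hpos : 0 < ∑ v : ∀ i, X i, ∑ h : ∀ i, X i,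
      (∏ i, ∏ j, U i j (v i) (h j)) * ∏ j, γ j (h j)) :
    (fun v : ∀ i, X i => (∑ h : ∀ i, X i, (∏ i, ∏ j, U i j (v i) (h j)) * ∏ j, γ j (h j)) /
      ∑ v : ∀ i, X i, ∑ h : ∀ i, X i, (∏ i, ∏ j, U i j (v i) (h j)) * ∏ j, γ j (h j)) ∈
      closure (rbmMarginals X) := by
  have key := apply_zero_mem_closure (s := rbmMarginals X)
    (f := fun ε v => (∑ h : ∀ i, X i,
        (∏ i, ∏ j, (U i j (v i) (h j) + ε)) * ∏ j, (γ j (h j) + ε)) /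
      ∑ v : ∀ i, X i, ∑ h : ∀ i, X i,
        (∏ i, ∏ j, (U i j (v i) (h j) + ε)) * ∏ j, (γ j (h j) + ε)) ?_ ?_
  · simpa only [add_zero] using key
  · refine continuousAt_pi.2 fun v => ContinuousAt.div ?_ ?_ ?_
    · fun_prop
    · fun_prop
    · simpa only [add_zero] using hpos.ne'
  · intro ε hε
    refine ⟨fun i j v h => Real.log (U i j v h + ε), fun _ _ => 0,
      fun j h => Real.log (γ j h + ε), ?_⟩
    have h : ∀ v h : ∀ i, X i, Real.exp ((∑ i, ∑ j, Real.log (U i j (v i) (h j) + ε)) +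
        (∑ _i : Fin n, (0 : ℝ)) + ∑ j, Real.log (γ j (h j) + ε)) =
        (∏ i, ∏ j, (U i j (v i) (h j) + ε)) * ∏ j, (γ j (h j) + ε) := fun v h => by
      rw [Finset.sum_const_zero, add_zero, Real.exp_add]
      simp only [Real.exp_sum]
      congr 1
      · exact Finset.prod_congr rfl fun i _ => Finset.prod_congr rfl fun j _ =>
          Real.exp_log (by linarith [hU i j (v i) (h j)])
      · exact Finset.prod_congr rfl fun j _ => Real.exp_log (by linarith [hγ j (h j)])
    simp only [dbnRBMJoint, h, Finset.sum_div]

lemma propagate_mem_closure {l : ℕ} {Q : (∀ i, X i) → ℝ} {κ : ∀ i, X i → (∀ j, X j) → ℝ}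
    (hQ : Q ∈ closure (layerStack X l)) (hκ : ∀ i, κ i ∈ closure (unitKernels X i)) :
    propagate X Q κ ∈ closure (layerStack X (l + 1)) := by
  have hκ' : κ ∈ closure (Set.univ.pi fun i => unitKernels X i) := by
    rw [closure_pi_set]
    exact fun i _ => hκ i
  refine map_mem_closure₂ (f := propagate X) ?_ hQ hκ' fun Q hQ κ hκ =>
    ⟨Q, hQ, κ, fun i => hκ i trivial, rfl⟩
  unfold Function.uncurry propagate
  fun_prop

variable [∀ i, DecidableEq (X i)]

open Classical in
/-- A unit can resample its state on a face of the state space, with probabilities depending on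
one further coordinate, and copy its state elsewhere. -/
lemma sharing_mem_closure_unitKernels (i d : Fin n) (J : Finset (Fin n)) (a : ∀ j, X j)
    (g : X i → X d → ℝ) (hg0 : ∀ y w, 0 ≤ g y w) (hg1 : ∀ w, ∑ y, g y w = 1) :
    (fun y z => if z i = a i ∧ ∀ j ∈ J, z j = a j then g y (z d) else if y = z i then 1 else 0) ∈
      closure (unitKernels X i) := by
  have pos : ∀ g : X i → X d → ℝ, (∀ y w, 0 < g y w) → (∀ w, ∑ y, g y w = 1) →
      (fun y z => if z i = a i ∧ ∀ j ∈ J, z j = a j then g y (z d)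
        else if y = z i then 1 else 0) ∈ closure (unitKernels X i) := by
    intro g hg0 hg1
    let A : ℝ → X i → (∀ j, X j) → ℝ := fun ε y z =>
      ∏ j, if j ∈ J ∧ z j ≠ a j ∧ y ≠ a i then ε else 1
    have hA0 : ∀ y z, A 0 y z = if (∃ j ∈ J, z j ≠ a j) ∧ y ≠ a i then 0 else 1 := by
      intro y z
      split_ifs with h
      · obtain ⟨⟨j, hj, hz⟩, hy⟩ := h
        exact Finset.prod_eq_zero (Finset.mem_univ j) (if_pos ⟨hj, hz, hy⟩)
      · exact Finset.prod_eq_one fun j _ => if_neg fun hj => h ⟨⟨j, hj.1, hj.2.1⟩, hj.2.2⟩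
    have hAa : ∀ ε z, A ε (a i) z = 1 := fun ε z => Finset.prod_eq_one fun j _ => by simp
    have hApos : ∀ ε, 0 < ε → ∀ y z, 0 < A ε y z := fun ε hε y z =>
      Finset.prod_pos fun j _ => by split_ifs <;> linarith
    have hsum : ∀ ε, 0 ≤ ε → ∀ z, 0 < ∑ y, A ε y z * g y (z d) := by
      intro ε hε z
      refine Finset.sum_pos' (fun y _ => mul_nonneg (Finset.prod_nonneg fun j _ => ?_)
        (hg0 _ _).le) ⟨a i, Finset.mem_univ _, ?_⟩
      · split_ifs <;> linarith
      · rw [hAa, one_mul]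
        exact hg0 _ _
    have key := apply_zero_mem_closure (s := closure (unitKernels X i))
      (f := fun ε y z => if z i = a i then A ε y z * g y (z d) / ∑ y', A ε y' z * g y' (z d)
        else if y = z i then 1 else 0) ?_ ?_
    · rw [closure_closure] at key
      convert key using 3 with y z
      by_cases hz : z i = a i
      · by_cases hJ : ∀ j ∈ J, z j = a j
        · have : ∀ y, A 0 y z = 1 := fun y => by
            rw [hA0, if_neg]
            rintro ⟨⟨j, hj, h⟩, -⟩
            exact h (hJ j hj)
          rw [if_pos ⟨hz, hJ⟩, if_pos hz]
          simp only [this, one_mul, hg1, div_one]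
        · have hJ' : ∃ j ∈ J, z j ≠ a j := by simpa using hJ
          simp only [hA0, hz, hJ, hJ', and_false, true_and, if_true, if_false]
          simp only [ite_not, ite_mul, one_mul, zero_mul, Finset.sum_ite_eq', Finset.mem_univ,
            if_true]
          split_ifs with h
          · rw [h, div_self (hg0 _ _).ne']
          · rw [zero_div]
      · simp [hz]
    · refine continuousAt_pi.2 fun y => continuousAt_pi.2 fun z => ?_
      by_cases hz : z i = a i
      · simp only [hz, if_true]
        have hc : ∀ y, Continuous fun ε => A ε y z := fun y =>
          continuous_finsetProd _ fun j _ => by split_ifs <;> fun_prop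
        exact ContinuousAt.div (by fun_prop) (by fun_prop) (hsum 0 le_rfl z).ne'
      · simp only [hz, if_false]
        exact continuousAt_const
    · intro ε hε
      let c : X i → X i → ℝ := fun y w => if w = a i ∨ y = w then 1 else 0
      let U : ∀ j, X i → X j → ℝ := fun j y w =>
        (if j ∈ J ∧ w ≠ a j ∧ y ≠ a i then ε else 1) *
          Function.update (fun j (_ : X j) => (1 : ℝ)) i (c y) j w *
          Function.update (fun j (_ : X j) => (1 : ℝ)) d (g y) j w
      have hU : ∀ y (z : ∀ j, X j), ∏ j, U j y (z j) = A ε y z * c y (z i) * g y (z d) := by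
        intro y z
        simp only [U, Finset.prod_mul_distrib, prod_update_one, A]
      have hU0 : ∀ j y w, 0 ≤ U j y w := by
        intro j y w
        refine mul_nonneg (mul_nonneg (by split_ifs <;> linarith) ?_) ?_
        · by_cases h : j = i
          · subst h
            simp only [Function.update_self, c]
            split_ifs <;> norm_num
          · rw [Function.update_of_ne h]
            exact zero_le_one
        · by_cases h : j = d
          · subst h
            simpa only [Function.update_self] using (hg0 y w).le
          · rw [Function.update_of_ne h]
            exact zero_le_one
      have hc : ∀ y w, w = a i → c y w = 1 := fun y w hw => if_pos (Or.inl hw)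
      have hc' : ∀ y w, w ≠ a i → c y w = if y = w then 1 else 0 := fun y w hw => by
        simp [c, hw]
      have hsumU : ∀ z : ∀ j, X j, 0 < ∑ y, ∏ j, U j y (z j) := by
        intro z
        simp only [hU]
        by_cases hz : z i = a i
        · simpa only [hc _ _ hz, mul_one] using hsum ε hε.le z
        · simpa [hc' _ _ hz] using mul_pos (hApos ε hε _ _) (hg0 _ _)
      convert unitKernels_closure_of_nonneg i U hU0 hsumU using 3 with y z
      simp only [hU]
      by_cases hz : z i = a i
      · simp only [hz, if_true, hc _ _ rfl, mul_one]
      · simp only [hz, if_false, hc' _ _ hz, mul_ite, mul_one, mul_zero, ite_mul, zero_mul,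
          Finset.sum_ite_eq', Finset.mem_univ, if_true]
        split_ifs with h
        · rw [h, div_self (mul_pos (hApos ε hε _ _) (hg0 _ _)).ne']
        · rw [zero_div]
  have hcard : (0 : ℝ) < Fintype.card (X i) := by
    exact_mod_cast Fintype.card_pos_iff.2 ⟨a i⟩
  have key := apply_zero_mem_closure (s := closure (unitKernels X i))
    (f := fun ε y z => if z i = a i ∧ ∀ j ∈ J, z j = a j
      then (g y (z d) + ε) / (1 + ε * Fintype.card (X i)) else if y = z i then 1 else 0) ?_ ?_
  · simpa using key
  · refine continuousAt_pi.2 fun y => continuousAt_pi.2 fun z => ?_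
    split_ifs
    · exact ContinuousAt.div (by fun_prop) (by fun_prop) (by simp)
    · exact continuousAt_const
    · exact continuousAt_const
  · intro ε hε
    refine pos (fun y w => (g y w + ε) / (1 + ε * Fintype.card (X i)))
      (fun y w => div_pos (by linarith [hg0 y w]) (by positivity)) fun w => ?_
    rw [← Finset.sum_div, Finset.sum_add_distrib, hg1, Finset.sum_const, nsmul_eq_mul,
      Finset.card_univ, mul_comm ε]
    exact div_self (by positivity)

lemma prod_add_of_disjoint (hn : 0 < n) (ε : ℝ) (F : Fin n → ℝ)
    (hF : ∀ j j', j ≠ j' → F j = 0 ∨ F j' = 0) :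
    ∏ j, (ε + F j) = ε ^ (n - 1) * (ε + ∑ j, F j) := by
  obtain ⟨j₀, hj₀⟩ : ∃ j₀, ∀ j, j ≠ j₀ → F j = 0 := by
    by_cases h : ∃ j, F j ≠ 0
    · obtain ⟨j, hj⟩ := h
      exact ⟨j, fun j' hj' => (hF j' j hj').resolve_right hj⟩
    · push Not at h
      exact ⟨⟨0, hn⟩, fun j _ => h j⟩
  rw [Fintype.sum_eq_single j₀ hj₀, ← Finset.mul_prod_erase _ _ (Finset.mem_univ j₀), mul_comm]
  congr 1
  rw [Finset.prod_congr rfl fun j hj => by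
    rw [hj₀ j (Finset.ne_of_mem_erase hj), add_zero], Finset.prod_const,
    Finset.card_erase_of_mem (Finset.mem_univ _), Finset.card_univ, Fintype.card_fin]

/-- Mixtures of `n` product measures with disjoint supports are limits of RBM marginals. -/
lemma mixture_mem_closure_rbmMarginals (hn : 0 < n) [∀ i, Nontrivial (X i)]
    (u : ∀ _j i : Fin n, X i → ℝ) (hu : ∀ j i x, 0 ≤ u j i x)
    (hdisj : ∀ (v : ∀ i, X i) (j j' : Fin n), j ≠ j' →
      ∏ i, u j i (v i) = 0 ∨ ∏ i, u j' i (v i) = 0)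
    (hsum : ∑ v : ∀ i, X i, ∑ j, ∏ i, u j i (v i) = 1) :
    (fun v : ∀ i, X i => ∑ j, ∏ i, u j i (v i)) ∈ closure (rbmMarginals X) := by
  choose s t hst using fun j : Fin n => exists_pair_ne (X j)
  have key := apply_zero_mem_closure (s := closure (rbmMarginals X))
    (f := fun ε (v : ∀ i, X i) => (ε + ∑ j, ∏ i, u j i (v i)) /
      (Fintype.card (∀ i, X i) * ε + 1)) ?_ ?_
  · simpa using key
  · refine continuousAt_pi.2 fun v => ContinuousAt.div (by fun_prop) (by fun_prop) (by simp)
  · intro ε hε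
    let γ : ∀ j, X j → ℝ := fun j h => if h = s j then 1 else if h = t j then ε else 0
    let U : ∀ i j : Fin n, X i → X j → ℝ := fun i j x h => if h = s j then u j i x else 1
    have hγ : ∀ j h, 0 ≤ γ j h := fun j h => by
      simp only [γ]
      split_ifs <;> linarith
    have hU : ∀ i j x h, 0 ≤ U i j x h := fun i j x h => by
      simp only [U]
      split_ifs
      · exact hu _ _ _
      · exact zero_le_one
    have hh : ∀ v : ∀ i, X i, ∑ h : ∀ i, X i,
        (∏ i, ∏ j, U i j (v i) (h j)) * ∏ j, γ j (h j) =
        ε ^ (n - 1) * (ε + ∑ j, ∏ i, u j i (v i)) := by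
      intro v
      rw [← prod_add_of_disjoint hn ε _ (hdisj v)]
      have : ∀ j, ε + ∏ i, u j i (v i) = ∑ h : X j, (∏ i, U i j (v i) h) * γ j h := by
        intro j
        rw [Fintype.sum_eq_add (s j) (t j) (hst j) fun h hh => by simp [γ, hh.1, hh.2]]
        simp [γ, U, (hst j).symm, add_comm]
      simp only [this]
      rw [Fintype.prod_sum]
      refine Finset.sum_congr rfl fun h _ => ?_
      rw [Finset.prod_comm, Finset.prod_mul_distrib]
    have hZ : ∑ v : ∀ i, X i, ∑ h : ∀ i, X i,
        (∏ i, ∏ j, U i j (v i) (h j)) * ∏ j, γ j (h j) =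
        ε ^ (n - 1) * (Fintype.card (∀ i, X i) * ε + 1) := by
      simp only [hh]
      rw [← Finset.mul_sum, Finset.sum_add_distrib, hsum]
      simp
    have hmem := rbmMarginals_closure_of_nonneg U γ hU hγ (by rw [hZ]; positivity)
    rw [hZ] at hmem
    simp only [hh] at hmem
    convert hmem using 2 with v
    rw [mul_div_mul_left _ _ (by positivity)]

end Kernels

section DiscreteDBN

variable {n : ℕ} {X : Fin n → Type} [∀ i, Fintype (X i)] [∀ i, DecidableEq (X i)]

/-- Summing out the layers of a directed chain from the deep end. -/
lemma sum_chain_succ (L : ℕ) (K : Fin (L + 1) → (∀ i, X i) → (∀ i, X i) → ℝ)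
    (r : (∀ i, X i) → (∀ i, X i) → ℝ) (v : ∀ i, X i) :
    (∑ xs : Fin (L + 1 + 2) → (∀ i, X i), if xs 0 = v then
      r (xs ⟨L + 1, by omega⟩) (xs ⟨L + 1 + 1, by omega⟩) *
        ∏ l : Fin (L + 1), K l (xs l.castSucc.castSucc) (xs l.succ.castSucc) else 0) =
    ∑ z, (∑ xs : Fin (L + 2) → (∀ i, X i), if xs 0 = z then
      r (xs ⟨L, by omega⟩) (xs ⟨L + 1, by omega⟩) *
        ∏ l : Fin L, K l.succ (xs l.castSucc.castSucc) (xs l.succ.castSucc) else 0) * K 0 v z := by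
  rw [← (Fin.consEquiv fun _ : Fin (L + 1 + 2) => ∀ i, X i).sum_comp, Fintype.sum_prod_type,
    Fintype.sum_eq_single v fun w hw => by simp [Fin.consEquiv, hw]]
  simp only [Finset.sum_mul]
  rw [Finset.sum_comm]
  refine Finset.sum_congr rfl fun xs _ => ?_
  rw [Fintype.sum_eq_single (xs 0) fun w hw => by simp [hw.symm]]
  simp only [Fin.consEquiv, Equiv.coe_fn_mk, Fin.cons_zero, if_true, Fin.prod_univ_succ]
  have h1 : (⟨L + 1, by omega⟩ : Fin (L + 1 + 2)) = Fin.succ ⟨L, by omega⟩ := rfl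
  have h2 : (⟨L + 1 + 1, by omega⟩ : Fin (L + 1 + 2)) = Fin.succ ⟨L + 1, by omega⟩ := rfl
  rw [h1, h2]
  simp only [Fin.castSucc_zero, Fin.cons_zero, Fin.cons_succ, ← Fin.succ_castSucc]
  ring

lemma layerStack_subset_discreteDBN (L : ℕ) : layerStack X L ⊆ discreteDBN X L := by
  induction L with
  | zero =>
    rintro P ⟨W, b, c, rfl⟩
    refine ⟨Fin.elim0, Fin.elim0, W, b, c, fun v => ?_⟩
    rw [← (Fin.consEquiv fun _ : Fin (0 + 2) => ∀ i, X i).sum_comp, Fintype.sum_prod_type,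
      Fintype.sum_eq_single v fun w hw => by simp [Fin.consEquiv, hw],
      ← (Equiv.funUnique (Fin 1) (∀ i, X i)).symm.sum_comp]
    simp [Fin.consEquiv]
  | succ L ih =>
    rintro P ⟨Q, hQ, κ, hκ, rfl⟩
    obtain ⟨W, b, Wr, br, cr, hQ⟩ := ih hQ
    choose W₀ b₀ hκ using hκ
    refine ⟨Fin.cons W₀ W, Fin.cons b₀ b, Wr, br, cr, fun v => ?_⟩
    refine Eq.trans ?_ (sum_chain_succ L (fun l x z => ∏ i, dbnCond X i
      ((Fin.cons W₀ W : Fin (L + 1) → ∀ i j : Fin n, X i → X j → ℝ) l i)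
      ((Fin.cons b₀ b : Fin (L + 1) → ∀ i : Fin n, X i → ℝ) l i) (x i) z) _ v).symm
    simp only [Fin.cons_zero, Fin.cons_succ, propagate, hκ, hQ]

end DiscreteDBN

section Sharing

variable {n : ℕ} {X : Fin n → Type} [∀ i, Fintype (X i)] [∀ i, DecidableEq (X i)]

open Classical in
/-- Push `P` forward along the map which, on `Λ`, resets the coordinate `ι z` to the root `o`. -/
noncomputable def resetLine (Λ : Set (∀ i, X i)) (ι : (∀ i, X i) → Fin n) (o : ∀ i, X i)
    (P : (∀ i, X i) → ℝ) (z : ∀ i, X i) : ℝ :=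
  if z ∈ Λ then if z (ι z) = o (ι z) then ∑ y, P (Function.update z (ι z) y) else 0 else P z

variable {Λ : Set (∀ i, X i)} {ι : (∀ i, X i) → Fin n} {o : ∀ i, X i} {P : (∀ i, X i) → ℝ}

lemma resetLine_nonneg (hP : ∀ x, 0 ≤ P x) (z : ∀ i, X i) : 0 ≤ resetLine Λ ι o P z := by
  unfold resetLine
  split_ifs
  exacts [Finset.sum_nonneg fun _ _ => hP _, le_rfl, hP z]

open Classical in
lemma resetLine_of_mem {z : ∀ i, X i} {i : Fin n} (hz : z ∈ Λ) (hi : ι z = i) :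
    resetLine Λ ι o P z = if z i = o i then ∑ y, P (Function.update z i y) else 0 := by
  subst hi
  rw [resetLine, if_pos hz]

lemma resetLine_of_notMem {z : ∀ i, X i} (hz : z ∉ Λ) : resetLine Λ ι o P z = P z := by
  rw [resetLine, if_neg hz]

open Classical in
/-- The conditional distribution of the coordinate `i` under `P`, given the other coordinates. -/
noncomputable def lineCond (o : ∀ i, X i) (P : (∀ i, X i) → ℝ) (i : Fin n) (y : X i)
    (z : ∀ j, X j) : ℝ :=
  if ∑ y', P (Function.update z i y') = 0 then if y = o i then 1 else 0
  else P (Function.update z i y) / ∑ y', P (Function.update z i y')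

lemma lineCond_nonneg (hP : ∀ x, 0 ≤ P x) (i : Fin n) (y : X i) (z : ∀ j, X j) :
    0 ≤ lineCond o P i y z := by
  unfold lineCond
  split_ifs
  exacts [zero_le_one, le_rfl, div_nonneg (hP _) (Finset.sum_nonneg fun _ _ => hP _)]

lemma sum_lineCond (i : Fin n) (z : ∀ j, X j) : ∑ y, lineCond o P i y z = 1 := by
  unfold lineCond
  split_ifs with h
  · simp
  · rw [← Finset.sum_div, div_self h]

lemma sum_mul_lineCond (hP : ∀ x, 0 ≤ P x) (i : Fin n) (y : X i) (z : ∀ j, X j) :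
    (∑ y', P (Function.update z i y')) * lineCond o P i y z = P (Function.update z i y) := by
  unfold lineCond
  split_ifs with h h'
  · rw [h, zero_mul, (Finset.sum_eq_zero_iff_of_nonneg fun _ _ => hP _).1 h y (Finset.mem_univ _)]
  · rw [h, zero_mul, (Finset.sum_eq_zero_iff_of_nonneg fun _ _ => hP _).1 h y (Finset.mem_univ _)]
  · rw [mul_div_cancel₀ _ h]

open Classical in
/-- The kernel of unit `i` undoing `resetLine`. -/
noncomputable def expandKernel (Λ : Set (∀ i, X i)) (ι : (∀ i, X i) → Fin n) (o : ∀ i, X i)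
    (P : (∀ i, X i) → ℝ) (i : Fin n) (y : X i) (z : ∀ j, X j) : ℝ :=
  if z i = o i ∧ z ∈ Λ ∧ ι z = i then lineCond o P i y z else if y = z i then 1 else 0

lemma expandKernel_of_not {z : ∀ j, X j} {i : Fin n} (h : ¬(z ∈ Λ ∧ ι z = i)) (y : X i) :
    expandKernel Λ ι o P i y z = if y = z i then 1 else 0 := by
  rw [expandKernel, if_neg fun h' => h h'.2]

lemma sum_expandKernel (i : Fin n) (z : ∀ j, X j) : ∑ y, expandKernel Λ ι o P i y z = 1 := by
  unfold expandKernel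
  split_ifs
  · exact sum_lineCond i z
  · simp

lemma propagate_resetLine (hP : ∀ x, 0 ≤ P x)
    (hΛ : ∀ z ∈ Λ, ∀ y, Function.update z (ι z) y ∈ Λ ∧ ι (Function.update z (ι z) y) = ι z) :
    propagate X (resetLine Λ ι o P) (expandKernel Λ ι o P) = P := by
  have hΛ' : ∀ z ∈ Λ, ∀ i, ι z = i → ∀ y, Function.update z i y ∈ Λ ∧
      ι (Function.update z i y) = i := by
    rintro z hz _ rfl y
    exact hΛ z hz y
  funext x
  by_cases hx : x ∈ Λ
  · obtain ⟨i, hi⟩ : ∃ i, ι x = i := ⟨_, rfl⟩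
    have hz := hΛ' x hx i hi (o i)
    rw [propagate, Fintype.sum_eq_single (Function.update x i (o i)),
      Fintype.prod_eq_single i, resetLine_of_mem hz.1 hz.2, if_pos (Function.update_self ..),
      expandKernel, if_pos ⟨Function.update_self .., hz⟩, sum_mul_lineCond hP,
      Function.update_idem, Function.update_eq_self]
    · intro j hj
      rw [expandKernel_of_not fun h => hj (h.2.symm.trans hz.2), if_pos]
      rw [Function.update_of_ne hj]
    · intro z hzx
      by_cases hzΛ : z ∈ Λ
      · by_cases hzo : z (ι z) = o (ι z)
        · by_cases hagree : ∀ j, j ≠ ι z → x j = z j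
          · have hxz : x = Function.update z (ι z) (x (ι z)) := by
              funext j
              by_cases hj : j = ι z
              · subst hj
                rw [Function.update_self]
              · rw [Function.update_of_ne hj, hagree j hj]
            have hι : ι z = i := by
              rw [← hi, hxz]
              exact (hΛ z hzΛ _).2.symm
            refine absurd ?_ hzx
            subst hι
            rw [hxz, Function.update_idem, ← hzo, Function.update_eq_self]
          · push Not at hagree
            obtain ⟨j, hj, hjz⟩ := hagree
            rw [Finset.prod_eq_zero (Finset.mem_univ j), mul_zero]
            rw [expandKernel_of_not fun h => hj h.2.symm, if_neg hjz]
        · rw [resetLine_of_mem hzΛ rfl, if_neg hzo, zero_mul]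
      · obtain ⟨j, hj⟩ : ∃ j, x j ≠ z j := by
          by_contra! h
          exact hzΛ (funext h ▸ hx)
        rw [Finset.prod_eq_zero (Finset.mem_univ j), mul_zero]
        rw [expandKernel_of_not fun h => hzΛ h.1, if_neg hj]
  · rw [propagate, Fintype.sum_eq_single x, resetLine_of_notMem hx, Finset.prod_eq_one, mul_one]
    · intro i _
      rw [expandKernel_of_not fun h => hx h.1, if_pos rfl]
    · intro z hzx
      by_cases hzΛ : z ∈ Λ
      · by_cases hagree : ∀ j, j ≠ ι z → x j = z j
        · refine absurd ?_ hx
          have hxz : x = Function.update z (ι z) (x (ι z)) := by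
            funext j
            by_cases hj : j = ι z
            · subst hj
              rw [Function.update_self]
            · rw [Function.update_of_ne hj, hagree j hj]
          rw [hxz]
          exact (hΛ z hzΛ _).1
        · push Not at hagree
          obtain ⟨j, hj, hjz⟩ := hagree
          rw [Finset.prod_eq_zero (Finset.mem_univ j), mul_zero]
          rw [expandKernel_of_not fun h => hj h.2.symm, if_neg hjz]
      · obtain ⟨j, hj⟩ : ∃ j, x j ≠ z j := by
          by_contra! h
          exact hzx (funext h).symm
        rw [Finset.prod_eq_zero (Finset.mem_univ j), mul_zero]
        rw [expandKernel_of_not fun h => hzΛ h.1, if_neg hj]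

lemma sum_resetLine (hP : ∀ x, 0 ≤ P x)
    (hΛ : ∀ z ∈ Λ, ∀ y, Function.update z (ι z) y ∈ Λ ∧ ι (Function.update z (ι z) y) = ι z) :
    ∑ z, resetLine Λ ι o P z = ∑ x, P x := by
  conv_rhs => rw [← propagate_resetLine (o := o) hP hΛ]
  unfold propagate
  rw [Finset.sum_comm]
  refine Finset.sum_congr rfl fun z _ => ?_
  rw [← Finset.mul_sum, ← Fintype.prod_sum fun i y => expandKernel Λ ι o P i y z]
  simp [sum_expandKernel]

lemma expandKernel_mem_closure (hP : ∀ x, 0 ≤ P x) (d : Fin n)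
    (hΛ : ∀ z ∈ Λ, ∀ y, Function.update z (ι z) y ∈ Λ ∧ ι (Function.update z (ι z) y) = ι z)
    (hface : ∀ a ∈ Λ, ∃ J : Finset (Fin n), ∀ z, z ∈ Λ ∧ ι z = ι a ↔ ∀ j ∈ J, z j = a j)
    (hdep : ∀ z ∈ Λ, ∀ z' ∈ Λ, ι z = ι z' → z (ι z) = z' (ι z) → z d = z' d → P z = P z')
    (i : Fin n) : expandKernel Λ ι o P i ∈ closure (unitKernels X i) := by
  classical
  by_cases hex : ∃ a ∈ Λ, ι a = i
  · obtain ⟨a, ha, hi⟩ := hex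
    have hΛ' : ∀ z ∈ Λ, ι z = i → ∀ y, Function.update z i y ∈ Λ ∧
        ι (Function.update z i y) = i := by
      rintro z hz rfl y
      exact hΛ z hz y
    obtain ⟨ha', hι⟩ := hΛ' a ha hi (o i)
    obtain ⟨J, hJ⟩ := hface _ ha'
    rw [hι] at hJ
    let g : X i → X d → ℝ := fun y w =>
      if h : ∃ z, (z i = o i ∧ z ∈ Λ ∧ ι z = i) ∧ z d = w then lineCond o P i y h.choose
      else if y = o i then 1 else 0
    have hg : ∀ y z, (z i = o i ∧ z ∈ Λ ∧ ι z = i) → lineCond o P i y z = g y (z d) := by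
      rintro y z ⟨hzo, hz, hzi⟩
      have h : ∃ z', (z' i = o i ∧ z' ∈ Λ ∧ ι z' = i) ∧ z' d = z d := ⟨z, ⟨hzo, hz, hzi⟩, rfl⟩
      simp only [g, dif_pos h]
      obtain ⟨⟨ho, hmem, hιz⟩, hd⟩ := h.choose_spec
      have heq : ∀ y, P (Function.update h.choose i y) = P (Function.update z i y) := by
        intro y
        obtain ⟨h1, h2⟩ := hΛ' _ hmem hιz y
        obtain ⟨h3, h4⟩ := hΛ' _ hz hzi y
        refine hdep _ h1 _ h3 (h2.trans h4.symm) ?_ ?_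
        · rw [h2, Function.update_self, Function.update_self]
        · by_cases hdi : d = i
          · subst hdi
            rw [Function.update_self, Function.update_self]
          · rw [Function.update_of_ne hdi, Function.update_of_ne hdi, hd]
      simp only [lineCond, heq]
    have hmem := sharing_mem_closure_unitKernels i d J (Function.update a i (o i)) g ?_ ?_
    · convert hmem using 3 with y z
      simp only [Function.update_self, ← hJ z, expandKernel]
      split_ifs with h
      exacts [hg y z h, rfl, rfl]
    · intro y w
      simp only [g]
      split_ifs
      exacts [lineCond_nonneg hP _ _ _, zero_le_one, le_rfl]
    · intro w
      simp only [g]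
      split_ifs
      · exact sum_lineCond _ _
      · simp
  · have hmem := sharing_mem_closure_unitKernels i d ∅ o (fun y _ => if y = o i then 1 else 0)
      (fun y w => by split_ifs <;> norm_num) (fun w => by simp)
    convert hmem using 3 with y z
    rw [expandKernel_of_not fun h => hex ⟨z, h⟩]
    by_cases hz : z i = o i <;> simp [hz]

lemma mem_closure_layerStack_succ (hP : ∀ x, 0 ≤ P x) (d : Fin n)
    (hΛ : ∀ z ∈ Λ, ∀ y, Function.update z (ι z) y ∈ Λ ∧ ι (Function.update z (ι z) y) = ι z)
    (hface : ∀ a ∈ Λ, ∃ J : Finset (Fin n), ∀ z, z ∈ Λ ∧ ι z = ι a ↔ ∀ j ∈ J, z j = a j)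
    (hdep : ∀ z ∈ Λ, ∀ z' ∈ Λ, ι z = ι z' → z (ι z) = z' (ι z) → z d = z' d → P z = P z')
    {l : ℕ} (hl : resetLine Λ ι o P ∈ closure (layerStack X l)) :
    P ∈ closure (layerStack X (l + 1)) := by
  rw [← propagate_resetLine (o := o) hP hΛ]
  exact propagate_mem_closure hl (expandKernel_mem_closure hP d hΛ hface hdep)

lemma mem_closure_layerStack_mono (hP : ∀ x, 0 ≤ P x) (d : Fin n) (o : ∀ i, X i) {l l' : ℕ}
    (hll' : l ≤ l') (hl : P ∈ closure (layerStack X l)) : P ∈ closure (layerStack X l') := by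
  induction hll' with
  | refl => exact hl
  | step _ ih =>
    refine mem_closure_layerStack_succ (Λ := ∅) (ι := fun _ => d) (o := o) hP d
      (by simp) (by simp) (by simp) ?_
    convert ih using 1
    exact funext fun z => resetLine_of_notMem (by simp)

end Sharing

section Schedule

variable {n : ℕ} {X : Fin n → Type}

/-- The combinatorial data steering the sharing layers. The coordinates from `m + 1` on carry a
label in `Fin m`; states with label `k` are distributed successively along the coordinates
`coord k 0, …, coord k (S - 1)`, and no two labels use the same coordinate at the same stage. -/
structure SharingSchedule (X : Fin n → Type) (m S q : ℕ) where
  label : (∀ i, X i) → Fin m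
  label_eq_iff : ∀ x x', label x = label x' ↔ ∀ j : Fin n, m + 1 ≤ (j : ℕ) → x j = x' j
  coord : Fin m → ℕ → Fin n
  coord_lt : ∀ k r, (coord k r : ℕ) < m
  coord_injOn : ∀ k r r', r < S → r' < S → coord k r = coord k r' → r = r'
  coord_left_injective : ∀ r k k', coord k r = coord k' r → k = k'
  code : ∀ j, X j → ℕ
  code_injective : ∀ j, Function.Injective (code j)
  code_lt : ∀ (j : Fin n) x, (j : ℕ) < m → code j x < q
  root : ∀ j, X j
  pivot : Fin n
  eq_pivot_or : ∀ j : Fin n, m ≤ (j : ℕ) → j = pivot ∨ m + 1 ≤ (j : ℕ)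

namespace SharingSchedule

variable {m S q : ℕ} (D : SharingSchedule X m S q)

/-- The coordinate along which the state `x` is distributed at stage `s`. -/
def lineCoord (s : ℕ) (x : ∀ i, X i) : Fin n := D.coord (D.label x) s

/-- A number encoding the values of the first `s` scheduled coordinates of `x`. -/
def prefixCode (x : ∀ i, X i) : ℕ → ℕ
  | 0 => 0
  | s + 1 => prefixCode x s * q + D.code _ (x (D.lineCoord s x))

lemma prefixCode_lt (x : ∀ i, X i) (s : ℕ) : D.prefixCode x s < q ^ s := by
  induction s with
  | zero => simp [prefixCode]
  | succ s ih =>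
    have h := D.code_lt _ (x (D.lineCoord s x)) (D.coord_lt _ _)
    rw [prefixCode, pow_succ]
    nlinarith

lemma prefixCode_eq_iff {x x' : ∀ i, X i} (hk : D.label x = D.label x') (s : ℕ) :
    D.prefixCode x s = D.prefixCode x' s ↔
      ∀ r < s, x (D.lineCoord r x) = x' (D.lineCoord r x) := by
  induction s with
  | zero => simp [prefixCode]
  | succ s ih =>
    have h := D.code_lt _ (x (D.lineCoord s x)) (D.coord_lt _ _)
    have h' := D.code_lt _ (x' (D.lineCoord s x')) (D.coord_lt _ _)
    have hline : D.lineCoord s x' = D.lineCoord s x := by rw [lineCoord, lineCoord, hk]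
    rw [hline] at h'
    rw [prefixCode, prefixCode, Nat.forall_lt_succ_right, ← ih, hline,
      ← (D.code_injective _).eq_iff]
    constructor
    · intro he
      have hq : 0 < q := by omega
      have h1 := congrArg (· / q) he
      have h2 := congrArg (· % q) he
      simp only [Nat.mul_add_mod_of_lt h, Nat.mul_add_mod_of_lt h'] at h2
      simp only [mul_comm _ q, Nat.mul_add_div hq, Nat.div_eq_of_lt h, Nat.div_eq_of_lt h',
        add_zero] at h1
      exact ⟨h1, h2⟩
    · rintro ⟨h1, h2⟩
      rw [h1, h2]

lemma label_update (x : ∀ i, X i) (j : Fin n) (hj : (j : ℕ) < m) (y : X j) :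
    D.label (Function.update x j y) = D.label x := by
  rw [D.label_eq_iff]
  intro i hi
  rw [Function.update_of_ne]
  rintro rfl
  omega

/-- The states distributed at stage `s` in the time slot `τ`. -/
def slot (s τ : ℕ) : Set (∀ i, X i) :=
  {x | D.prefixCode x s = τ ∧
    ∀ r, s < r → r < S → x (D.lineCoord r x) = D.root (D.lineCoord r x)}

/-- Two states are equivalent if they agree in the coordinates from `m` on and in all scheduled
coordinates. -/
def Equivalent (x x' : ∀ i, X i) : Prop :=
  (∀ j : Fin n, m ≤ (j : ℕ) → x j = x' j) ∧
    ∀ r < S, x (D.lineCoord r x) = x' (D.lineCoord r x)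

/-- A function on the state space that is constant on equivalence classes. -/
def Invariant (P : (∀ i, X i) → ℝ) : Prop :=
  ∀ x x', D.Equivalent x x' → P x = P x'

variable {D}

lemma Equivalent.label_eq {x x' : ∀ i, X i} (h : D.Equivalent x x') : D.label x = D.label x' :=
  (D.label_eq_iff _ _).2 fun j hj => h.1 j (by omega)

lemma lineCoord_eq {x x' : ∀ i, X i} (h : D.label x = D.label x') (s : ℕ) :
    D.lineCoord s x = D.lineCoord s x' := by
  rw [lineCoord, lineCoord, h]

lemma Equivalent.symm {x x' : ∀ i, X i} (h : D.Equivalent x x') : D.Equivalent x' x :=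
  ⟨fun j hj => (h.1 j hj).symm, fun r hr => by
    rw [lineCoord_eq h.label_eq.symm]
    exact (h.2 r hr).symm⟩

lemma Equivalent.trans {x y z : ∀ i, X i} (h : D.Equivalent x y) (h' : D.Equivalent y z) :
    D.Equivalent x z :=
  ⟨fun j hj => (h.1 j hj).trans (h'.1 j hj), fun r hr => by
    have := h'.2 r hr
    rw [lineCoord_eq h.label_eq.symm] at this
    exact (h.2 r hr).trans this⟩

lemma Equivalent.update {x x' : ∀ i, X i} (h : D.Equivalent x x') (i : Fin n) (hi : (i : ℕ) < m)
    (y : X i) : D.Equivalent (Function.update x i y) (Function.update x' i y) := by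
  refine ⟨fun j hj => ?_, fun r hr => ?_⟩
  · have : j ≠ i := by
      rintro rfl
      omega
    rw [Function.update_of_ne this, Function.update_of_ne this, h.1 j hj]
  · rw [lineCoord_eq (D.label_update x i hi y)]
    by_cases hj : D.lineCoord r x = i
    · rw [hj, Function.update_self, Function.update_self]
    · rw [Function.update_of_ne hj, Function.update_of_ne hj, h.2 r hr]

lemma mem_slot_of_equivalent {x x' : ∀ i, X i} (h : D.Equivalent x x') {s τ : ℕ} (hs : s < S)
    (hx : x ∈ D.slot s τ) : x' ∈ D.slot s τ := by
  refine ⟨?_, fun r hsr hr => ?_⟩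
  · rw [← hx.1]
    exact (D.prefixCode_eq_iff h.label_eq.symm s).2 fun r hr => h.symm.2 r (by omega)
  · rw [lineCoord_eq h.label_eq.symm, ← h.2 r hr]
    exact hx.2 r hsr hr

lemma update_mem_slot {s τ : ℕ} (hs : s < S) {x : ∀ i, X i} (hx : x ∈ D.slot s τ)
    (y : X (D.lineCoord s x)) : Function.update x (D.lineCoord s x) y ∈ D.slot s τ ∧
      D.lineCoord s (Function.update x (D.lineCoord s x) y) = D.lineCoord s x := by
  have hlabel := D.label_update x (D.lineCoord s x) (D.coord_lt _ _) y
  have hne : ∀ r < S, r ≠ s → D.lineCoord r x ≠ D.lineCoord s x := fun r hr hrs h =>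
    hrs (D.coord_injOn _ _ _ hr hs h)
  refine ⟨⟨?_, fun r hsr hr => ?_⟩, lineCoord_eq hlabel s⟩
  · rw [← hx.1]
    refine ((D.prefixCode_eq_iff hlabel.symm s).2 fun r hr => ?_).symm
    rw [Function.update_of_ne (hne r (by omega) (by omega))]
  · rw [lineCoord_eq hlabel, Function.update_of_ne (hne r hr (by omega))]
    exact hx.2 r hsr hr

lemma slot_face {s τ : ℕ} (hs : s < S) {a : ∀ i, X i} (ha : a ∈ D.slot s τ) :
    ∃ J : Finset (Fin n), ∀ z, z ∈ D.slot s τ ∧ D.lineCoord s z = D.lineCoord s a ↔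
      ∀ j ∈ J, z j = a j := by
  classical
  refine ⟨Finset.univ.filter fun j => m + 1 ≤ (j : ℕ) ∨ ∃ r < S, r ≠ s ∧ D.lineCoord r a = j,
    fun z => ?_⟩
  simp only [Finset.mem_filter, Finset.mem_univ, true_and]
  constructor
  · rintro ⟨hz, hza⟩ j hj
    have hlabel : D.label a = D.label z := D.coord_left_injective _ _ _ hza.symm
    rcases hj with hj | ⟨r, hr, hrs, rfl⟩
    · exact (D.label_eq_iff _ _).1 hlabel.symm j hj
    · rcases lt_or_gt_of_ne hrs with h | h
      · exact ((D.prefixCode_eq_iff hlabel s).1 (ha.1.trans hz.1.symm) r h).symm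
      · rw [ha.2 r h hr, lineCoord_eq hlabel, hz.2 r h hr]
  · intro h
    have hlabel : D.label a = D.label z :=
      (D.label_eq_iff _ _).2 fun j hj => (h j (Or.inl hj)).symm
    refine ⟨⟨?_, fun r hsr hr => ?_⟩, lineCoord_eq hlabel.symm s⟩
    · rw [← ha.1]
      exact ((D.prefixCode_eq_iff hlabel s).2 fun r hr =>
        (h _ (Or.inr ⟨r, by omega, by omega, rfl⟩)).symm).symm
    · rw [← lineCoord_eq hlabel, h _ (Or.inr ⟨r, hr, by omega, rfl⟩)]
      exact ha.2 r hsr hr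

lemma equivalent_of_mem_slot {s τ : ℕ} {z z' : ∀ i, X i} (hz : z ∈ D.slot s τ)
    (hz' : z' ∈ D.slot s τ) (hline : D.lineCoord s z = D.lineCoord s z')
    (hs : z (D.lineCoord s z) = z' (D.lineCoord s z)) (hp : z D.pivot = z' D.pivot) :
    D.Equivalent z z' := by
  have hlabel : D.label z = D.label z' := D.coord_left_injective _ _ _ hline
  refine ⟨fun j hj => ?_, fun r hr => ?_⟩
  · rcases D.eq_pivot_or j hj with rfl | h
    · exact hp
    · exact (D.label_eq_iff _ _).1 hlabel j h
  · rcases lt_trichotomy r s with h | rfl | h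
    · exact (D.prefixCode_eq_iff hlabel s).1 (hz.1.trans hz'.1.symm) r h
    · exact hs
    · rw [hz.2 r h hr, lineCoord_eq hlabel, hz'.2 r h hr]

variable [∀ i, Fintype (X i)]

section Layers

variable [∀ i, DecidableEq (X i)] {P : (∀ i, X i) → ℝ}

lemma Invariant.resetLine (hP : D.Invariant P) {s : ℕ} (hs : s < S) (τ : ℕ) :
    D.Invariant (resetLine (D.slot s τ) (D.lineCoord s) D.root P) := by
  intro x x' h
  by_cases hx : x ∈ D.slot s τ
  · rw [resetLine_of_mem hx rfl, resetLine_of_mem (mem_slot_of_equivalent h hs hx)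
      (lineCoord_eq h.label_eq.symm s), h.2 s hs]
    exact if_congr Iff.rfl (Finset.sum_congr rfl fun y _ =>
      hP _ _ (h.update _ (D.coord_lt _ _) y)) rfl
  · rw [resetLine_of_notMem hx,
      resetLine_of_notMem fun h' => hx (mem_slot_of_equivalent h.symm hs h'), hP _ _ h]

/-- Once the scheduled coordinates are all at their roots, the distribution is generated by the
top RBM. -/
lemma mem_closure_rbmMarginals [∀ i, Nontrivial (X i)] (hmn : m ≤ n) (hP : ∀ x, 0 ≤ P x)
    (hsum : ∑ x, P x = 1) (hinv : D.Invariant P)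
    (hsupp : ∀ x, P x ≠ 0 → ∀ r < S, x (D.lineCoord r x) = D.root (D.lineCoord r x)) :
    P ∈ closure (rbmMarginals X) := by
  classical
  have hn : 0 < n := D.pivot.pos
  let rooted : (∀ i, X i) → Prop := fun x =>
    ∀ r < S, x (D.lineCoord r x) = D.root (D.lineCoord r x)
  have hcomp : ∀ k : Fin n, ∃ u : ∀ i, X i → ℝ, (∀ i x, 0 ≤ u i x) ∧
      ∀ v : ∀ i, X i, ∏ i, u i (v i) = if (D.label v : ℕ) = k ∧ rooted v then P v else 0 := by
    intro k
    by_cases hex : ∃ a, (D.label a : ℕ) = k ∧ rooted a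
    · obtain ⟨a, hak, ha⟩ := hex
      let J : Finset (Fin n) := Finset.univ.filter fun j =>
        m + 1 ≤ (j : ℕ) ∨ ∃ r < S, D.lineCoord r a = j
      refine ⟨fun i x => (if i ∈ J → x = a i then 1 else 0) * Function.update
        (fun i (_ : X i) => (1 : ℝ)) D.pivot (fun w => P (Function.update a D.pivot w)) i x,
        fun i x => mul_nonneg (by split_ifs <;> norm_num) ?_, fun v => ?_⟩
      · by_cases hi : i = D.pivot
        · subst hi
          rw [Function.update_self]
          exact hP _
        · rw [Function.update_of_ne hi]
          exact zero_le_one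
      · rw [Finset.prod_mul_distrib, prod_update_one, Finset.prod_boole]
        have hJ : (∀ i ∈ Finset.univ, i ∈ J → v i = a i) ↔ (D.label v : ℕ) = k ∧ rooted v := by
          constructor
          · intro h
            have hlabel : D.label v = D.label a := (D.label_eq_iff _ _).2 fun j hj =>
              h j (Finset.mem_univ _) (by simpa [J] using Or.inl hj)
            refine ⟨by rw [hlabel, hak], fun r hr => ?_⟩
            rw [lineCoord_eq hlabel, h _ (Finset.mem_univ _)
              (by simpa [J] using Or.inr ⟨r, hr, rfl⟩)]
            exact ha r hr
          · rintro ⟨hvk, hv⟩ j - hj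
            have hlabel : D.label v = D.label a := Fin.ext (hvk.trans hak.symm)
            simp only [J, Finset.mem_filter, Finset.mem_univ, true_and] at hj
            rcases hj with hj | ⟨r, hr, rfl⟩
            · exact (D.label_eq_iff _ _).1 hlabel j hj
            · rw [ha r hr, ← lineCoord_eq hlabel, hv r hr]
        by_cases h : (D.label v : ℕ) = k ∧ rooted v
        · rw [if_pos (hJ.2 h), if_pos h, one_mul]
          have hva := hJ.2 h
          have hlabel : D.label v = D.label a := Fin.ext (h.1.trans hak.symm)
          refine (hinv _ _ ⟨fun j hj => ?_, fun r hr => ?_⟩).symm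
          · by_cases hjp : j = D.pivot
            · subst hjp
              rw [Function.update_self]
            · rw [Function.update_of_ne hjp]
              exact hva j (Finset.mem_univ _)
                (by simpa [J] using Or.inl ((D.eq_pivot_or j hj).resolve_left hjp))
          · by_cases hjp : D.lineCoord r v = D.pivot
            · rw [hjp, Function.update_self]
            · rw [Function.update_of_ne hjp]
              refine hva _ (Finset.mem_univ _) ?_
              rw [lineCoord_eq hlabel]
              simpa [J] using Or.inr ⟨r, hr, rfl⟩
        · rw [if_neg fun h' => h (hJ.1 h'), if_neg h, zero_mul]
    · refine ⟨fun _ _ => 0, fun _ _ => le_rfl, fun v => ?_⟩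
      rw [if_neg fun h => hex ⟨v, h⟩]
      simp [hn.ne']
  choose u hu0 hu using hcomp
  have hPu : ∀ v : ∀ i, X i, ∑ k, ∏ i, u k i (v i) = P v := by
    intro v
    simp only [hu]
    rw [Fintype.sum_eq_single (Fin.castLE hmn (D.label v)) fun k hk =>
      if_neg fun h => hk (Fin.ext h.1.symm)]
    by_cases hv : rooted v
    · rw [if_pos ⟨rfl, hv⟩]
    · rw [if_neg fun h => hv h.2]
      by_contra h
      exact hv (hsupp v (Ne.symm h))
  have hmem := mixture_mem_closure_rbmMarginals hn u hu0 (fun v j j' hjj' => ?_) ?_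
  · simpa only [hPu] using hmem
  · rw [hu, hu]
    by_cases hj : (D.label v : ℕ) = j
    · exact Or.inr (if_neg fun h => hjj' (Fin.ext (hj.symm.trans h.1)))
    · exact Or.inl (if_neg fun h => hj h.1)
  · simpa only [hPu] using hsum

lemma mem_closure_layerStack_slot {s l : ℕ} (hs : s < S)
    (ih : ∀ P : (∀ i, X i) → ℝ, (∀ x, 0 ≤ P x) → ∑ x, P x = 1 → D.Invariant P →
      (∀ x, P x ≠ 0 → ∀ r, s ≤ r → r < S → x (D.lineCoord r x) = D.root (D.lineCoord r x)) →
      P ∈ closure (layerStack X l))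
    (τ : ℕ) (hP : ∀ x, 0 ≤ P x) (hsum : ∑ x, P x = 1) (hinv : D.Invariant P)
    (hsupp : ∀ x, P x ≠ 0 → ∀ r, s < r → r < S → x (D.lineCoord r x) = D.root (D.lineCoord r x))
    (hτ : ∀ x, P x ≠ 0 → D.prefixCode x s < τ ∨
      x (D.lineCoord s x) = D.root (D.lineCoord s x)) :
    P ∈ closure (layerStack X (l + τ)) := by
  induction τ generalizing P with
  | zero =>
    refine ih P hP hsum hinv fun x hx r hr hrS => ?_
    rcases hr.eq_or_lt with rfl | h
    · exact (hτ x hx).resolve_left (Nat.not_lt_zero _)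
    · exact hsupp x hx r h hrS
  | succ τ ihτ =>
    refine mem_closure_layerStack_succ (Λ := D.slot s τ) (ι := D.lineCoord s) (o := D.root)
      hP D.pivot (fun z hz => update_mem_slot hs hz) (fun a ha => slot_face hs ha)
      (fun z hz z' hz' h1 h2 h3 => hinv _ _ (equivalent_of_mem_slot hz hz' h1 h2 h3))
      (ihτ (resetLine_nonneg hP) ?_ (hinv.resetLine hs τ) ?_ ?_)
    · rw [sum_resetLine hP fun z hz => update_mem_slot hs hz, hsum]
    · intro x hx
      by_cases hxΛ : x ∈ D.slot s τ
      · exact hxΛ.2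
      · rw [resetLine_of_notMem hxΛ] at hx
        exact hsupp x hx
    · intro x hx
      by_cases hxΛ : x ∈ D.slot s τ
      · rw [resetLine_of_mem hxΛ rfl] at hx
        exact Or.inr (by_contra fun h => hx (if_neg h))
      · rw [resetLine_of_notMem hxΛ] at hx
        refine (hτ x hx).imp_left fun h => lt_of_le_of_ne (by omega) fun h' => hxΛ ⟨h', ?_⟩
        exact hsupp x hx

lemma mem_closure_layerStack_stage [∀ i, Nontrivial (X i)] (hmn : m ≤ n) {s : ℕ} (hs : s ≤ S)
    (hP : ∀ x, 0 ≤ P x) (hsum : ∑ x, P x = 1) (hinv : D.Invariant P)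
    (hsupp : ∀ x, P x ≠ 0 → ∀ r, s ≤ r → r < S →
      x (D.lineCoord r x) = D.root (D.lineCoord r x)) :
    P ∈ closure (layerStack X (∑ r ∈ Finset.range s, q ^ r)) := by
  induction s generalizing P with
  | zero =>
    exact mem_closure_rbmMarginals hmn hP hsum hinv fun x hx r hr => hsupp x hx r r.zero_le hr
  | succ s ih =>
    rw [Finset.sum_range_succ]
    exact mem_closure_layerStack_slot hs (fun P hP hsum hinv => ih (by omega) hP hsum hinv) _ hP
      hsum hinv (fun x hx r hr => hsupp x hx r hr) fun x _ => Or.inl (D.prefixCode_lt x s)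

/-- Invariant distributions are limits of distributions generated by the scheduled number of
layers. -/
lemma Invariant.mem_closure_layerStack [∀ i, Nontrivial (X i)] (hmn : m ≤ n)
    (hinv : D.Invariant P) (hP : ∀ x, 0 ≤ P x) (hsum : ∑ x, P x = 1) {L : ℕ}
    (hL : ∑ r ∈ Finset.range S, q ^ r ≤ L) : P ∈ closure (layerStack X L) :=
  mem_closure_layerStack_mono hP D.pivot D.root hL <|
    mem_closure_layerStack_stage hmn le_rfl hP hsum hinv fun _ _ _ h h' => absurd h' (by omega)

end Layers

open Classical in
/-- The equivalence class of `x`. -/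
noncomputable def block (D : SharingSchedule X m S q) (x : ∀ i, X i) : Finset (∀ i, X i) :=
  Finset.univ.filter (D.Equivalent x)

lemma mem_block {x x' : ∀ i, X i} : x' ∈ D.block x ↔ D.Equivalent x x' := by
  simp [block]

lemma self_mem_block (x : ∀ i, X i) : x ∈ D.block x :=
  mem_block.2 ⟨fun _ _ => rfl, fun _ _ => rfl⟩

lemma Equivalent.block_eq {x x' : ∀ i, X i} (h : D.Equivalent x x') : D.block x = D.block x' := by
  ext y
  rw [mem_block, mem_block]
  exact ⟨h.symm.trans, h.trans⟩

lemma card_block_pos (x : ∀ i, X i) : 0 < ((D.block x).card : ℝ) := by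
  exact_mod_cast Finset.card_pos.2 ⟨x, self_mem_block x⟩

lemma val_le_val_of_strictMono {k l : ℕ} {f : Fin k → Fin l} (hf : StrictMono f) :
    ∀ (i : ℕ) (hi : i < k), i ≤ (f ⟨i, hi⟩ : ℕ)
  | 0, _ => Nat.zero_le _
  | i + 1, hi =>
    (val_le_val_of_strictMono hf i (by omega)).trans_lt
      (hf (Fin.mk_lt_mk.2 i.lt_succ_self))

/-- The blocks are at most as large as the product of the `m - S` largest state spaces among the
first `m`. -/
lemma card_block_le (hmn : m ≤ n) (hS : S ≤ m)
    (hsorted : ∀ i j : Fin n, (i : ℕ) ≤ (j : ℕ) → (j : ℕ) < m →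
      Fintype.card (X j) ≤ Fintype.card (X i)) (x : ∀ i, X i) :
    (D.block x).card ≤ ∏ j ∈ Finset.univ.filter (fun j : Fin n => (j : ℕ) < m - S),
      Fintype.card (X j) := by
  classical
  let C : Finset (Fin n) := (Finset.range S).image fun r => D.lineCoord r x
  let M : Finset (Fin n) := Finset.univ.filter fun j => (j : ℕ) < m
  have hCM : C ⊆ M := by
    intro j hj
    obtain ⟨r, -, rfl⟩ := Finset.mem_image.1 hj
    exact Finset.mem_filter.2 ⟨Finset.mem_univ _, D.coord_lt _ _⟩
  have hC : C.card = S := by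
    rw [Finset.card_image_of_injOn, Finset.card_range]
    intro r hr r' hr' h
    exact D.coord_injOn _ _ _ (by simpa using hr) (by simpa using hr') h
  have hcard : ∀ (k : ℕ) (hk : k ≤ n), (Finset.univ.filter fun j : Fin n => (j : ℕ) < k) =
      Finset.univ.map (Fin.castLEEmb hk) := by
    intro k hk
    ext j
    simp only [Finset.mem_filter, Finset.mem_univ, true_and, Finset.mem_map]
    exact ⟨fun h => ⟨⟨j, h⟩, rfl⟩, by rintro ⟨i, rfl⟩; exact i.2⟩
  have hU : (M \ C).card = m - S := by
    rw [Finset.card_sdiff_of_subset hCM, hC]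
    simp only [M]
    rw [hcard m hmn, Finset.card_map, Finset.card_univ, Fintype.card_fin]
  calc (D.block x).card
      ≤ (Fintype.piFinset fun j => if j ∈ M \ C then Finset.univ else {x j}).card := by
        refine Finset.card_le_card fun y hy => Fintype.mem_piFinset.2 fun j => ?_
        split_ifs with hj
        · exact Finset.mem_univ _
        · rw [mem_block] at hy
          rw [Finset.mem_singleton]
          by_cases hjC : j ∈ C
          · obtain ⟨r, hr, rfl⟩ := Finset.mem_image.1 hjC
            exact (hy.2 r (Finset.mem_range.1 hr)).symm
          · have hjM : j ∉ M := fun h => hj (Finset.mem_sdiff.2 ⟨h, hjC⟩)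
            exact (hy.1 j (by simpa [M] using hjM)).symm
    _ = ∏ j ∈ M \ C, Fintype.card (X j) := by
        rw [Fintype.card_piFinset, Finset.prod_congr rfl fun j _ =>
          (apply_ite Finset.card (j ∈ M \ C) Finset.univ {x j})]
        simp only [Finset.card_univ, Finset.card_singleton]
        rw [Finset.prod_ite_mem, Finset.univ_inter]
    _ = ∏ i : Fin (m - S), Fintype.card (X ((M \ C).orderEmbOfFin hU i)) := by
        conv_lhs => rw [← Finset.map_orderEmbOfFin_univ (M \ C) hU, Finset.prod_map]
        rfl
    _ ≤ ∏ i : Fin (m - S), Fintype.card (X (Fin.castLE (by omega) i)) := by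
        refine Finset.prod_le_prod' fun i _ => hsorted _ _ ?_ ?_
        · exact val_le_val_of_strictMono ((M \ C).orderEmbOfFin hU).strictMono i.1 i.2
        · have := (M \ C).orderEmbOfFin_mem hU i
          simp only [M, Finset.mem_sdiff, Finset.mem_filter] at this
          exact this.1.2
    _ = _ := by
        rw [hcard (m - S) (by omega), Finset.prod_map]
        rfl

/-- The average of `p` over the equivalence classes. -/
noncomputable def blockAverage (D : SharingSchedule X m S q) (p : (∀ i, X i) → ℝ)
    (x : ∀ i, X i) : ℝ :=
  (∑ y ∈ D.block x, p y) / (D.block x).card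

lemma blockAverage_nonneg {p : (∀ i, X i) → ℝ} (hp : ∀ x, 0 ≤ p x) (x : ∀ i, X i) :
    0 ≤ D.blockAverage p x :=
  div_nonneg (Finset.sum_nonneg fun _ _ => hp _) (Nat.cast_nonneg _)

lemma le_card_mul_blockAverage {p : (∀ i, X i) → ℝ} (hp : ∀ x, 0 ≤ p x) (x : ∀ i, X i) :
    p x ≤ (D.block x).card * D.blockAverage p x := by
  rw [blockAverage, mul_div_cancel₀ _ (card_block_pos x).ne']
  exact Finset.single_le_sum (fun y _ => hp y) (self_mem_block x)

lemma invariant_blockAverage (p : (∀ i, X i) → ℝ) : D.Invariant (D.blockAverage p) := by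
  intro x x' h
  rw [blockAverage, blockAverage, h.block_eq]

lemma sum_blockAverage (p : (∀ i, X i) → ℝ) : ∑ x, D.blockAverage p x = ∑ x, p x := by
  simp only [blockAverage, Finset.sum_div]
  rw [Finset.sum_comm' (t' := Finset.univ) (s' := D.block) fun x y => by
    simp only [Finset.mem_univ, true_and, and_true, mem_block]
    exact ⟨Equivalent.symm, Equivalent.symm⟩]
  refine Finset.sum_congr rfl fun y _ => ?_
  rw [Finset.sum_congr rfl fun x hx => by rw [← (mem_block.1 hx).block_eq], Finset.sum_const,
    nsmul_eq_mul, mul_div_cancel₀ _ (card_block_pos y).ne']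

end SharingSchedule

end Schedule

section Divergence

/-- A distribution dominated up to the factor `B` by a limit of model distributions has divergence
at most `log B` from the model. -/
lemma divFrom_le_log {𝒳 : Type*} [Fintype 𝒳] {M : Set (𝒳 → ℝ)} {p r : 𝒳 → ℝ} {B : ℝ}
    (hB : 0 < B) (hp : IsProb p) (hr : r ∈ closure M) (hpr : ∀ x, p x ≤ B * r x) :
    divFrom p M ≤ (Real.log B : EReal) := by
  refine EReal.le_of_forall_lt_iff_le.1 fun z hz => ?_
  rw [EReal.coe_lt_coe_iff, Real.log_lt_iff_lt_exp hB] at hz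
  have hopen : IsOpen {q : 𝒳 → ℝ | ∀ x, p x ≠ 0 → p x < Real.exp z * q x} := by
    simp only [Set.ofPred_forall]
    exact isOpen_iInter_of_finite fun x => isOpen_iInter_of_finite fun _ =>
      isOpen_lt continuous_const (by fun_prop)
  obtain ⟨q, hq, hqM⟩ := mem_closure_iff.1 hr _ hopen fun x hx => by
    have hpx : 0 < p x := lt_of_le_of_ne (hp.1 x) hx.symm
    have hrx : 0 < r x := pos_of_mul_pos_right (hpx.trans_le (hpr x)) hB.le
    exact (hpr x).trans_lt (mul_lt_mul_of_pos_right hz hrx)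
  refine (iInf₂_le q hqM).trans ?_
  have hqpos : ∀ x, p x ≠ 0 → 0 < q x := fun x hx =>
    pos_of_mul_pos_right ((hp.1 x).trans_lt (hq x hx)) (Real.exp_pos z).le
  rw [KL, if_pos fun x hx => (hqpos x hx).ne', EReal.coe_le_coe_iff]
  calc ∑ x, p x * Real.log (p x / q x) ≤ ∑ x, p x * z := by
        refine Finset.sum_le_sum fun x _ => ?_
        by_cases hx : p x = 0
        · simp [hx]
        · have hpx : 0 < p x := lt_of_le_of_ne (hp.1 x) (Ne.symm hx)
          refine mul_le_mul_of_nonneg_left ?_ hpx.le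
          rw [Real.log_le_iff_le_exp (div_pos hpx (hqpos x hx)), div_le_iff₀ (hqpos x hx)]
          exact (hq x hx).le
    _ = z := by rw [← Finset.sum_mul, hp.2, one_mul]

end Divergence

/-- A sharing schedule exists: label `k` uses the coordinates `k, k + 1, …` cyclically. -/
lemma exists_sharingSchedule {n : ℕ} (hn : 0 < n) (X : Fin n → Type) [∀ i, Fintype (X i)]
    [∀ i, Nonempty (X i)] {m S : ℕ} (hmn : m ≤ n) (hS : S ≤ m)
    (hprod : ∏ j ∈ Finset.univ.filter (fun j : Fin n => m + 1 ≤ (j : ℕ)),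
      Fintype.card (X j) ≤ m)
    (hsorted : ∀ j : Fin n, (j : ℕ) < m → Fintype.card (X j) ≤ Fintype.card (X ⟨0, hn⟩)) :
    Nonempty (SharingSchedule X m S (Fintype.card (X ⟨0, hn⟩))) := by
  have hm : 0 < m := lt_of_lt_of_le (Finset.prod_pos fun j _ => Fintype.card_pos) hprod
  obtain ⟨e⟩ : Nonempty ((∀ j : {j : Fin n // m + 1 ≤ (j : ℕ)}, X j) ↪ Fin m) := by
    classical
    refine Function.Embedding.nonempty_of_card_le ?_
    rw [Fintype.card_pi, Fintype.card_fin]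
    refine le_of_eq_of_le ?_ hprod
    exact (Finset.prod_subtype _ (by simp) fun j => Fintype.card (X j)).symm
  obtain ⟨d, hd⟩ : ∃ d : Fin n, ∀ j : Fin n, m ≤ (j : ℕ) → j = d ∨ m + 1 ≤ (j : ℕ) := by
    by_cases h : m < n
    · exact ⟨⟨m, h⟩, fun j hj => hj.eq_or_lt.imp_left fun h => Fin.ext h.symm⟩
    · exact ⟨⟨0, hn⟩, fun j hj => absurd j.2 (by omega)⟩
  exact ⟨{
    label := fun x => e fun j => x j
    label_eq_iff := fun x x' => by
      rw [e.injective.eq_iff, funext_iff, Subtype.forall]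
    coord := fun k r => ⟨(k + r) % m, (Nat.mod_lt _ hm).trans_le hmn⟩
    coord_lt := fun k r => Nat.mod_lt _ hm
    coord_injOn := fun k r r' hr hr' h => by
      have h1 : r ≡ r' [MOD m] := Nat.ModEq.add_left_cancel' (k : ℕ) (Fin.mk.inj h)
      exact Nat.ModEq.eq_of_lt_of_lt h1 (by omega) (by omega)
    coord_left_injective := fun r k k' h => by
      have h1 : (k : ℕ) ≡ k' [MOD m] := Nat.ModEq.add_right_cancel' r (Fin.mk.inj h)
      exact Fin.ext (Nat.ModEq.eq_of_lt_of_lt h1 k.2 k'.2)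
    code := fun j x => Fintype.equivFin (X j) x
    code_injective := fun j => Fin.val_injective.comp (Fintype.equivFin (X j)).injective
    code_lt := fun j x hj => (Fintype.equivFin (X j) x).2.trans_le (hsorted j hj)
    root := fun j => Classical.arbitrary _
    pivot := d
    eq_pivot_or := hd }⟩


/-- for a DBN with $L ≥ 2 + (q_1^S - 1)/(q_1 - 1)$ layers of width $n$,
with $∏_{j=m+2}^n q_j ≤ m ≤ n$ and $q_1 ≥ ⋯ ≥ q_m$, one has
$D_{DBN} ≤ \log(∏_{j=1}^{m-S} q_j)$. -/
theorem maxDiv_discreteDBN_le {n : ℕ} (hn : 0 < n) (X : Fin n → Type)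
    [∀ i, Fintype (X i)] [∀ i, DecidableEq (X i)]
    (hcard : ∀ j, 2 ≤ Fintype.card (X j))
    (m : ℕ) (hmn : m ≤ n)
    (hprod : ∏ j ∈ Finset.univ.filter (fun j : Fin n => m + 1 ≤ (j : ℕ)),
      Fintype.card (X j) ≤ m)
    (hsorted : ∀ i j : Fin n, (i : ℕ) ≤ (j : ℕ) → (j : ℕ) < m →
      Fintype.card (X j) ≤ Fintype.card (X i))
    (S : ℕ) (hS : S ≤ m) (L : ℕ)
    (hL : (2 : ℝ) + (((Fintype.card (X ⟨0, hn⟩) : ℝ) ^ S - 1) /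
      ((Fintype.card (X ⟨0, hn⟩) : ℝ) - 1)) ≤ (L : ℝ)) :
    maxDiv (discreteDBN X (L - 2)) ≤
      ((Real.log (∏ j ∈ Finset.univ.filter (fun j : Fin n => (j : ℕ) < m - S),
        (Fintype.card (X j) : ℝ))) : EReal) := by
  have hnontrivial : ∀ i, Nontrivial (X i) := fun i =>
    Fintype.one_lt_card_iff_nontrivial.1 (hcard i)
  have hq := hcard ⟨0, hn⟩
  have hq' : (1 : ℝ) < Fintype.card (X ⟨0, hn⟩) := by exact_mod_cast hq
  obtain ⟨D⟩ := exists_sharingSchedule (S := S) hn X hmn hS hprod fun j hj =>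
    hsorted ⟨0, hn⟩ j (Nat.zero_le _) hj
  have hlayers : ∑ r ∈ Finset.range S, Fintype.card (X ⟨0, hn⟩) ^ r ≤ L - 2 := by
    rw [← geom_sum_eq hq'.ne'] at hL
    have : 2 + ∑ r ∈ Finset.range S, Fintype.card (X ⟨0, hn⟩) ^ r ≤ L := by exact_mod_cast hL
    omega
  refine iSup₂_le fun p hp => ?_
  refine divFrom_le_log (r := D.blockAverage p)
    (Finset.prod_pos fun j _ => by exact_mod_cast Fintype.card_pos) hp ?_ fun x => ?_
  · exact closure_mono (layerStack_subset_discreteDBN _) <|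
      (SharingSchedule.invariant_blockAverage p).mem_closure_layerStack hmn
        (SharingSchedule.blockAverage_nonneg hp.1)
        ((SharingSchedule.sum_blockAverage p).trans hp.2) hlayers
  · refine (SharingSchedule.le_card_mul_blockAverage hp.1 x).trans
      (mul_le_mul_of_nonneg_right ?_ (SharingSchedule.blockAverage_nonneg hp.1 x))
    exact_mod_cast SharingSchedule.card_block_le hmn hS hsorted x
end
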